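/- arXiv:math/0309022 — 2 statements merged into one kernel-verified Lean document; each statement's English description precedes it below -/
import Mathlib

section
/- Let ζ ∈ ∂𝔻 and suppose z₀ ∈ Π(ζ) is a principal point of ζ at which K is locally connected. Then the impression is trivial: I(ζ) = {z₀}. -/
open Filter Topology Metric Set OnePoint

noncomputable section

local notation "ℂ∞" => OnePoint ℂ

/-- A set `K` is locally connected (connected im kleinen) at a point `z`:
every neighborhood of `z` in `K` contains a connected neighborhood of `z` in `K`. -/
def LocallyConnectedAt {X : Type*} [TopologicalSpace X] (K : Set X) (z : X) : Prop :=
  ∀ V ∈ 𝓝[K] z, ∃ N ∈ 𝓝[K] z, N ⊆ K ∩ V ∧ IsConnected N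

/-- `φ : ℂ → ℂ∞` is holomorphic, as a map into the Riemann sphere, on `D`:
near every point of `D` it is either given by an analytic `ℂ`-valued function, or by the
reciprocal of one. -/
def HolomorphicIntoSphereOn (φ : ℂ → ℂ∞) (D : Set ℂ) : Prop :=
  ∀ z ∈ D,
    (∃ g : ℂ → ℂ, AnalyticAt ℂ g z ∧ ∀ᶠ w in 𝓝 z, φ w = ((g w : ℂ) : ℂ∞)) ∨
    (∃ g : ℂ → ℂ, AnalyticAt ℂ g z ∧
      ∀ᶠ w in 𝓝 z, φ w = if g w = 0 then (∞ : ℂ∞) else (((g w)⁻¹ : ℂ) : ℂ∞))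

/-- The impression of the prime end `ζ ∈ ∂𝔻` (cluster set of `φ` at `ζ`). -/
def impression (φ : ℂ → ℂ∞) (ζ : ℂ) : Set ℂ∞ :=
  {z | ∃ w : ℕ → ℂ, (∀ j, w j ∈ ball (0 : ℂ) 1) ∧ Tendsto w atTop (𝓝 ζ) ∧
    Tendsto (fun j => φ (w j)) atTop (𝓝 z)}

/-- The set of principal points of the prime end `ζ` (radial cluster set of `φ` at `ζ`). -/
def principalPoints (φ : ℂ → ℂ∞) (ζ : ℂ) : Set ℂ∞ :=
  {z | ∃ t : ℕ → ℝ, (∀ j, t j ∈ Ico (0 : ℝ) 1) ∧ Tendsto t atTop (𝓝 1) ∧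
    Tendsto (fun j => φ ((t j : ℂ) * ζ)) atTop (𝓝 z)}

/-- The accumulation set of a curve `Γ : [0,∞) → ℂ∞`: all limits of sequences `Γ (t j)`
with `t j → ∞`. -/
def accSet (Γ : ℝ → ℂ∞) : Set ℂ∞ :=
  {z | ∃ t : ℕ → ℝ, Tendsto t atTop atTop ∧ Tendsto (fun j => Γ (t j)) atTop (𝓝 z)}

/-- `Γ` is a (continuous) curve `[0,∞) → U`. -/
def IsCurveIn (U : Set ℂ∞) (Γ : ℝ → ℂ∞) : Prop :=
  ContinuousOn Γ (Ici 0) ∧ MapsTo Γ (Ici 0) U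

/-- The curve `Γ : [0,∞) → U` converges to the prime end `ζ`: `φ⁻¹(Γ(t)) = ψ(Γ(t)) → ζ`. -/
def ConvergesToPrimeEnd (U : Set ℂ∞) (ψ : ℂ∞ → ℂ) (Γ : ℝ → ℂ∞) (ζ : ℂ) : Prop :=
  IsCurveIn U Γ ∧ Tendsto (fun t => ψ (Γ t)) atTop (𝓝 ζ)

/-- `Γ` converges to the prime end `ζ` from the left. -/
def ConvergesFromLeft (U : Set ℂ∞) (ψ : ℂ∞ → ℂ) (Γ : ℝ → ℂ∞) (ζ : ℂ) : Prop :=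
  ConvergesToPrimeEnd U ψ Γ ζ ∧ ∀ᶠ t in atTop, 0 ≤ (ψ (Γ t) / ζ).im

/-- `Γ` converges to the prime end `ζ` from the right. -/
def ConvergesFromRight (U : Set ℂ∞) (ψ : ℂ∞ → ℂ) (Γ : ℝ → ℂ∞) (ζ : ℂ) : Prop :=
  ConvergesToPrimeEnd U ψ Γ ζ ∧ ∀ᶠ t in atTop, (ψ (Γ t) / ζ).im ≤ 0

/-- The left wing `I⁺(ζ)` of the prime end `ζ`. -/
def leftWing (U : Set ℂ∞) (ψ : ℂ∞ → ℂ) (ζ : ℂ) : Set ℂ∞ :=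
  {z | ∃ Γ : ℝ → ℂ∞, ConvergesFromLeft U ψ Γ ζ ∧ z ∈ accSet Γ}

/-- The right wing `I⁻(ζ)` of the prime end `ζ`. -/
def rightWing (U : Set ℂ∞) (ψ : ℂ∞ → ℂ) (ζ : ℂ) : Set ℂ∞ :=
  {z | ∃ Γ : ℝ → ℂ∞, ConvergesFromRight U ψ Γ ζ ∧ z ∈ accSet Γ}

/-- `z` has priority over `w` in the left wing of `ζ`. -/
def PriorityLeft (U : Set ℂ∞) (ψ : ℂ∞ → ℂ) (ζ : ℂ) (z w : ℂ∞) : Prop :=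
  ∀ Γ : ℝ → ℂ∞, ConvergesFromLeft U ψ Γ ζ → w ∈ accSet Γ → z ∈ accSet Γ

/-- `z` has priority over `w` in the right wing of `ζ`. -/
def PriorityRight (U : Set ℂ∞) (ψ : ℂ∞ → ℂ) (ζ : ℂ) (z w : ℂ∞) : Prop :=
  ∀ Γ : ℝ → ℂ∞, ConvergesFromRight U ψ Γ ζ → w ∈ accSet Γ → z ∈ accSet Γ

/-- The sequence `w` accumulates at `z` (some subsequence converges to `z`). -/
def SeqAccumAt (w : ℕ → ℂ∞) (z : ℂ∞) : Prop :=
  ∃ n : ℕ → ℕ, StrictMono n ∧ Tendsto (fun j => w (n j)) atTop (𝓝 z)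

/-- `z₀` is strongly minimal in the prime end `ζ`: every sequence in `U` converging to the
prime end `ζ` and not accumulating at `z₀` lies on a curve converging to `ζ` whose
accumulation set misses `z₀`. -/
def StronglyMinimal (U : Set ℂ∞) (ψ : ℂ∞ → ℂ) (ζ : ℂ) (z₀ : ℂ∞) : Prop :=
  ∀ w : ℕ → ℂ∞, (∀ j, w j ∈ U) → Tendsto (fun j => ψ (w j)) atTop (𝓝 ζ) →
    ¬ SeqAccumAt w z₀ →
    ∃ Γ : ℝ → ℂ∞, ConvergesToPrimeEnd U ψ Γ ζ ∧ (∀ j, ∃ t, 0 ≤ t ∧ Γ t = w j) ∧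
      z₀ ∉ accSet Γ



lemma aux_const {X : Type*} [TopologicalSpace X] {S : Set X} (hS : IsPreconnected S) {d : X → ℂ}
    (hd : ContinuousOn d S) {c : ℂ} (h1 : ∀ x ∈ S, Complex.exp (d x) = c) {x y : X} (hx : x ∈ S)
    (hy : y ∈ S) : d x = d y := by
  have key : (fun z => ((d z - d y) / (2 * Real.pi * Complex.I)).re) x =
      (fun z => ((d z - d y) / (2 * Real.pi * Complex.I)).re) y := by
    refine hS.constant_of_mapsTo (T := range ((↑) : ℤ → ℝ))
      (f := fun z => ((d z - d y) / (2 * Real.pi * Complex.I)).re) ?_ ?_ ?_ hx hy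
    · rw [isDiscrete_iff_discreteTopology]
      exact (Int.isClosedEmbedding_coe_real.isEmbedding.toHomeomorph).symm.isEmbedding.discreteTopology
    · apply Complex.continuous_re.comp_continuousOn
      exact (hd.sub continuousOn_const).div_const _
    · intro z hz
      have : Complex.exp (d z - d y) = 1 := by
        rw [Complex.exp_sub, h1 z hz, h1 y hy, div_self]
        rw [← h1 y hy]; exact Complex.exp_ne_zero _
      obtain ⟨n, hn⟩ := Complex.exp_eq_one_iff.1 this
      refine ⟨n, ?_⟩
      simp only [hn]
      rw [mul_div_cancel_right₀ _ Complex.two_pi_I_ne_zero]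
      simp
  have : Complex.exp (d x - d y) = 1 := by
    rw [Complex.exp_sub, h1 x hx, h1 y hy, div_self]
    rw [← h1 y hy]; exact Complex.exp_ne_zero _
  obtain ⟨n, hn⟩ := Complex.exp_eq_one_iff.1 this
  simp only [hn] at key
  rw [mul_div_cancel_right₀ _ Complex.two_pi_I_ne_zero] at key
  simp at key
  rw [key] at hn
  simpa [sub_eq_zero] using hn

lemma aux_noext {F : ℂ → ℂ} (hF : Continuous F) (h0 : ∀ z, F z ≠ 0) {q : ℂ} {R : ℝ} (hR : 0 < R)
    (hq : ∀ z, dist z q = R → F z = z - q) : False := by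
  obtain ⟨G, hG, hGF⟩ : ∃ G : ℂ → ℂ, Continuous G ∧ EqOn (Complex.exp ∘ G) F univ := by
    rcases Complex.isCoveringMapOn_exp.existsUnique_continuousMap_lifts
      (⟨F, hF⟩ : C(ℂ, ℂ)) (a₀ := 0) (Complex.exp_log (h0 0)) (fun x => h0 x) with ⟨f, ⟨-, hf⟩, -⟩
    exact ⟨f, f.continuous, fun x _ => congrFun hf x⟩
  have := aux_const (S := (univ : Set ℝ)) isPreconnected_univ
    (d := fun t : ℝ => G (q + R * Complex.exp (t * Complex.I)) - t * Complex.I) (c := R)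
    (by fun_prop) (by
      intro t _
      have h2 := hGF (mem_univ (q + R * Complex.exp (t * Complex.I)))
      simp only [Function.comp] at h2
      rw [Complex.exp_sub, h2, hq]
      · field_simp [Complex.exp_ne_zero]
        ring
      · simp [dist_eq_norm, Complex.norm_exp_ofReal_mul_I, abs_of_pos hR]) (mem_univ 0) (mem_univ (2 * Real.pi))
  simp [Complex.exp_two_pi_mul_I] at this
  exact Complex.two_pi_I_ne_zero (by linear_combination this)

lemma aux_borsuk {V X : Set ℂ} (hV : IsOpen V) (hVb : Bornology.IsBounded V) (hX : IsClosed X)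
    (hVX : frontier V ⊆ X) {q : ℂ} (hq : q ∈ V) {L : ℂ → ℂ} (hL : ContinuousOn L X)
    (hL1 : ∀ z ∈ X, Complex.exp (L z) = z - q) : False := by
  classical
  obtain ⟨g, hg⟩ := ContinuousMap.exists_restrict_eq hX
    (⟨X.domRestrict L, continuousOn_iff_continuous_domRestrict.mp hL⟩ : C(X, ℂ))
  have hg' : ∀ z ∈ X, g z = L z := fun z hz => by
    have := congrArg (fun f => f ⟨z, hz⟩) hg
    simpa using this
  obtain ⟨R, hR0, hR⟩ := hVb.subset_closedBall_lt 0 q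
  refine aux_noext (F := fun z => if z ∈ V then Complex.exp (g z) else z - q) (q := q) (R := R + 1) ?_ ?_
    (by positivity) ?_
  · refine Continuous.if ?_ (by fun_prop) (by fun_prop)
    intro z hz
    have := hVX hz
    rw [hg' z this, hL1 z this]
  · intro z
    split_ifs with h
    · exact Complex.exp_ne_zero _
    · intro h2
      rw [sub_eq_zero] at h2
      exact h (h2 ▸ hq)
  · intro z hz
    rw [if_neg]
    intro h
    have := hR h
    rw [mem_closedBall] at this
    linarith

lemma aux_log_ball {z₀ q : ℂ} {ε : ℝ} (hq : ε < dist q z₀) :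
    ∃ l : ℂ → ℂ, ContinuousOn l (closedBall z₀ ε) ∧ ∀ z ∈ closedBall z₀ ε, Complex.exp (l z) = z - q := by
  by_cases hε : 0 ≤ ε
  swap
  · refine ⟨0, continuousOn_const, fun z hz => ?_⟩
    rw [mem_closedBall] at hz
    exact absurd (dist_nonneg.trans hz) hε
  have hne : z₀ - q ≠ 0 := by
    intro h
    rw [sub_eq_zero] at h
    rw [h, dist_self] at hq; linarith
  have hs : ∀ z ∈ closedBall z₀ ε, (z - q) / (z₀ - q) ∈ Complex.slitPlane := by
    intro z hz
    have h := Complex.mem_slitPlane_of_norm_lt_one (z := (z - z₀) / (z₀ - q)) (by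
      rw [norm_div, div_lt_one (norm_pos_iff.2 hne), ← dist_eq_norm, ← dist_eq_norm, dist_comm z₀ q]
      exact lt_of_le_of_lt hz hq)
    convert h using 1
    field_simp; ring
  refine ⟨fun z => Complex.log ((z - q) / (z₀ - q)) + Complex.log (z₀ - q), ?_, ?_⟩
  · refine ContinuousOn.add (ContinuousOn.clog (by fun_prop) hs) continuousOn_const
  · intro z hz
    rw [Complex.exp_add, Complex.exp_log (Complex.slitPlane_ne_zero (hs z hz)), Complex.exp_log hne]
    field_simp

lemma aux_sep {K V Γ N : Set ℂ} (hK : IsClosed K) (hV : IsOpen V) (hVb : Bornology.IsBounded V)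
    (hfr : frontier V ⊆ K ∪ Γ) (hN : IsClosed N) (hNc : IsPreconnected N) (hNK : N ⊆ K)
    {z₀ q : ℂ} (hz₀ : z₀ ∈ N) {ε : ℝ} (hΓ : Γ ⊆ closedBall z₀ ε) (hNε : N ⊆ closedBall z₀ ε)
    (hKΓ : K ∩ closure Γ ⊆ N) (hqV : q ∈ V) (hq : ε < dist q z₀) {l : ℂ → ℂ} (hl : ContinuousOn l K)
    (hl1 : ∀ z ∈ K, Complex.exp (l z) = z - q) : False := by
  classical
  obtain ⟨m, hm, hm1⟩ := aux_log_ball hq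
  set A := closure Γ ∪ N with hA
  have hAc : IsClosed A := isClosed_closure.union hN
  have hAε : A ⊆ closedBall z₀ ε := union_subset (closure_minimal hΓ isClosed_closedBall) hNε
  have hAK : ∀ z ∈ A, z ∈ K → z ∈ N := by
    rintro z (h | h) hz
    · exact hKΓ ⟨hz, h⟩
    · exact h
  have hconst : ∀ z ∈ N, l z - m z = l z₀ - m z₀ := by
    intro z hz
    refine aux_const (c := 1) hNc (d := fun z => l z - m z) ?_ ?_ hz hz₀
    · exact (hl.mono hNK).sub (hm.mono hNε)
    · intro x hx
      rw [Complex.exp_sub, hl1 x (hNK hx), ← hm1 x (hNε hx), div_self (Complex.exp_ne_zero _)]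
  have h1 : Complex.exp (l z₀ - m z₀) = 1 := by
    rw [Complex.exp_sub, hl1 _ (hNK hz₀), ← hm1 _ (hNε hz₀), div_self (Complex.exp_ne_zero _)]
  set L : ℂ → ℂ := fun z => if z ∈ K then l z - (l z₀ - m z₀) else m z with hL
  have hLK : EqOn L (fun z => l z - (l z₀ - m z₀)) K := fun z hz => by simp [hL, hz]
  have hLA : EqOn L m A := fun z hz => by
    by_cases h : z ∈ K
    · rw [hLK h]
      have := hconst z (hAK z hz h)
      simp only [← this]; ring
    · simp [hL, h]
  refine aux_borsuk (X := K ∪ A) hV hVb (hK.union hAc) ?_ hqV (L := L) ?_ ?_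
  · refine hfr.trans (union_subset_union_right _ ?_)
    exact subset_closure.trans subset_union_left
  · refine ContinuousOn.union_of_isClosed ?_ ?_ hK hAc
    · exact (hl.sub continuousOn_const).congr hLK
    · exact (hm.mono hAε).congr hLA
  · rintro z (h | h)
    · rw [hLK h, Complex.exp_sub, h1, div_one, hl1 z h]
    · rw [hLA h, hm1 z (hAε h)]

/-- logs on K -/
lemma aux_logK {U : Set (OnePoint ℂ)} (hU : IsOpen U) (hUc : IsPreconnected U) (hinf : ∞ ∈ U)
    {q : ℂ} (hq : (q : OnePoint ℂ) ∈ U) :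
    ∃ l : ℂ → ℂ, ContinuousOn l {z : ℂ | (z : OnePoint ℂ) ∉ U} ∧
      ∀ z : ℂ, (z : OnePoint ℂ) ∉ U → Complex.exp (l z) = z - q := by
  set K : Set ℂ := {z : ℂ | (z : OnePoint ℂ) ∉ U} with hKdef
  let P : ℂ → Prop := fun q => ∃ l : ℂ → ℂ, ContinuousOn l K ∧ ∀ z ∈ K, Complex.exp (l z) = z - q
  have hKU : K = ((↑) ⁻¹' U : Set ℂ)ᶜ := rfl
  have hKcomp : IsCompact K := ((isOpen_iff_of_mem hinf).1 hU).2
  have hKcl : IsClosed K := ((isOpen_iff_of_mem hinf).1 hU).1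
  have step : ∀ a b : ℂ, (∀ z ∈ K, dist b a < dist z a) → P a → P b := by
    rintro a b h ⟨l, hl, hl1⟩
    have hne : ∀ z ∈ K, z - a ≠ 0 := fun z hz h0 => by
      rw [sub_eq_zero] at h0
      have := h z hz
      rw [h0, dist_self] at this
      exact absurd this (not_lt.2 dist_nonneg)
    have hs : ∀ z ∈ K, (z - b) / (z - a) ∈ Complex.slitPlane := by
      intro z hz
      have h := Complex.mem_slitPlane_of_norm_lt_one (z := (a - b) / (z - a)) (by
        rw [norm_div, div_lt_one (norm_pos_iff.2 (hne z hz)), ← dist_eq_norm, ← dist_eq_norm, dist_comm a b]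
        exact h z hz)
      convert h using 1
      field_simp [hne z hz]; ring
    refine ⟨fun z => Complex.log ((z - b) / (z - a)) + l z, ?_, ?_⟩
    · refine ContinuousOn.add (ContinuousOn.clog ?_ hs) hl
      exact ContinuousOn.div (by fun_prop) (by fun_prop) hne
    · intro z hz
      rw [Complex.exp_add, Complex.exp_log (Complex.slitPlane_ne_zero (hs z hz)), hl1 z hz]
      field_simp [hne z hz]
  have hloc : ∀ a ∉ K, ∃ r > 0, ∀ b ∈ ball a r, b ∉ K ∧ (P a ↔ P b) := by
    intro a ha
    obtain ⟨r, hr, hrK⟩ := Metric.isOpen_iff.1 hKcl.isOpen_compl a ha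
    refine ⟨r / 2, by positivity, fun b hb => ⟨hrK (ball_subset_ball (by linarith) hb), ?_, ?_⟩⟩
    all_goals
      refine step _ _ fun z hz => ?_
      have h1 : r ≤ dist z a := by
        by_contra h
        exact hrK (mem_ball.2 (not_le.1 h)) hz
      rw [mem_ball] at hb
    · linarith
    · have := dist_triangle z b a
      rw [dist_comm a b]; linarith
  obtain ⟨R, hR0, hR⟩ := hKcomp.isBounded.subset_closedBall_lt 0 0
  have hbig : ∀ a : ℂ, R < dist a 0 → P a := by
    intro a ha
    obtain ⟨l, hl, hl1⟩ := aux_log_ball ha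
    exact ⟨l, hl.mono hR, fun z hz => hl1 z (hR hz)⟩
  by_contra hcon
  have hnP : ¬ P q := hcon
  let Q₂ : Set ℂ := {a | a ∉ K ∧ ¬ P a}
  let Q₁ : Set ℂ := {a | a ∉ K ∧ P a}
  have o2 : IsOpen Q₂ := by
    rw [Metric.isOpen_iff]
    rintro a ⟨ha, hPa⟩
    obtain ⟨r, hr, h⟩ := hloc a ha
    exact ⟨r, hr, fun b hb => ⟨(h b hb).1, fun hP => hPa ((h b hb).2.2 hP)⟩⟩
  have o1 : IsOpen Q₁ := by
    rw [Metric.isOpen_iff]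
    rintro a ⟨ha, hPa⟩
    obtain ⟨r, hr, h⟩ := hloc a ha
    exact ⟨r, hr, fun b hb => ⟨(h b hb).1, (h b hb).2.1 hPa⟩⟩
  have hQ1c : Q₁ᶜ ⊆ closedBall 0 R := by
    intro a ha
    by_contra h
    rw [mem_closedBall, not_le] at h
    apply ha
    refine ⟨fun hK => ?_, hbig a h⟩
    have := hR hK
    rw [mem_closedBall] at this; linarith
  have O1 : IsOpen (((↑) '' (Q₁ᶜ) : Set (OnePoint ℂ))ᶜ) := by
    rw [isOpen_compl_image_coe]
    exact ⟨o1.isClosed_compl, (isCompact_closedBall (0:ℂ) R).of_isClosed_subset o1.isClosed_compl hQ1c⟩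
  have O2 : IsOpen ((↑) '' Q₂ : Set (OnePoint ℂ)) := isOpen_image_coe.2 o2
  obtain ⟨x, hxU, hx1, hx2⟩ := hUc _ _ O1 O2 (by
      intro x hx
      induction x using OnePoint.rec with
      | infty => left; simp
      | coe x =>
        have hxK : x ∉ K := fun h => h hx
        by_cases hP : P x
        · left
          rintro ⟨y, hy, hyx⟩
          rw [OnePoint.coe_eq_coe] at hyx
          subst hyx
          exact hy ⟨hxK, hP⟩
        · right; exact ⟨x, ⟨hxK, hP⟩, rfl⟩) ⟨∞, hinf, by simp⟩ ⟨q, hq, q, ⟨fun h => h hq, hnP⟩, rfl⟩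
  obtain ⟨y, hy, rfl⟩ := hx2
  exact hx1 ⟨y, fun h => hy.2 h.2, rfl⟩

section aux
open MeasureTheory

lemma aux_area {g : ℂ → ℂ} {T : Set ℂ} (hg : ∀ z ∈ T, DifferentiableAt ℂ g z)
    (hTm : MeasurableSet T) (hinj : InjOn g T) :
    ∫⁻ z in T, ENNReal.ofReal (‖deriv g z‖ ^ 2) = volume (g '' T) := by
  rw [← lintegral_abs_det_fderiv_eq_addHaar_image volume hTm
    (f' := fun z => (ContinuousLinearMap.toSpanSingleton ℂ (deriv g z)).restrictScalars ℝ) _ hinj]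
  · congr 1
    ext z
    congr 1
    simp [ContinuousLinearMap.det, LinearMap.det_restrictScalars,
      Algebra.norm_complex_eq, Complex.normSq_eq_norm_sq]
  · intro z hz
    exact ((hg z hz).hasDerivAt.hasFDerivAt.restrictScalars ℝ).hasFDerivWithinAt

lemma aux_LA {g : ℂ → ℂ} {O T : Set ℂ} (hO : IsOpen O) (hg : DifferentiableOn ℂ g O) (hTO : T ⊆ O)
    (hTm : MeasurableSet T) (hinj : InjOn g T) {x0 x1 : ℝ} (hx : x0 < x1) {A : ℝ} (hA0 : 0 ≤ A)
    (hA : volume (g '' T) ≤ ENNReal.ofReal A) :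
    ∃ x ∈ Ioo x0 x1, ∀ y1 y2 : ℝ, y1 ≤ y2 → (∀ y ∈ Icc y1 y2, (x + y * Complex.I : ℂ) ∈ T) →
      ‖g (x + y2 * Complex.I) - g (x + y1 * Complex.I)‖ ^ 2 ≤ (y2 - y1) * (A / (x1 - x0)) := by
  have harea := aux_area (fun z hz => (hg.differentiableAt (hO.mem_nhds (hTO hz)))) hTm hinj
  set F : ℂ → ENNReal := fun z => ENNReal.ofReal (‖deriv g z‖ ^ 2) with hF
  have hFm : Measurable F := by
    have := measurable_deriv g
    fun_prop
  have hFTm : Measurable (T.indicator F) := hFm.indicator hTm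
  have e1 : ∫⁻ p : ℝ × ℝ, T.indicator F (p.1 + p.2 * Complex.I) = volume (g '' T) := by
    rw [← harea, ← lintegral_indicator hTm,
      ← Complex.volume_preserving_equiv_real_prod.symm.lintegral_comp hFTm]
    congr 1
    ext p
    congr 1
    apply Complex.ext <;> simp [Complex.measurableEquivRealProd]
  have hm2 : Measurable (fun p : ℝ × ℝ => T.indicator F (p.1 + p.2 * Complex.I)) := by
    apply hFTm.comp
    fun_prop
  rw [Measure.volume_eq_prod, lintegral_prod _ hm2.aemeasurable] at e1
  set h : ℝ → ENNReal := fun x => ∫⁻ y : ℝ, T.indicator F (x + y * Complex.I) with hh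
  have hhm : Measurable h := hm2.lintegral_prod_right'
  have hle : ∫⁻ x in Ioo x0 x1, h x ≤ ENNReal.ofReal A :=
    (setLIntegral_le_lintegral _ _).trans (e1.le.trans hA)
  have hL : 0 < x1 - x0 := sub_pos.2 hx
  obtain ⟨x, hxm, hxh⟩ := exists_le_setLAverage (μ := volume) (s := Ioo x0 x1) (f := h)
    (by simp [hx]) (by simp) hhm.aemeasurable
  have hxA : h x ≤ ENNReal.ofReal (A / (x1 - x0)) := by
    refine hxh.trans ?_
    rw [setLAverage_eq, Real.volume_Ioo, ENNReal.ofReal_div_of_pos hL]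
    gcongr
  refine ⟨x, hxm, fun y1 y2 hy hseg => ?_⟩
  have hcd : ContinuousOn (fun y : ℝ => deriv g (x + y * Complex.I)) (Icc y1 y2) := by
    refine (hg.deriv hO).continuousOn.comp (by fun_prop) ?_
    intro y hy
    exact hTO (hseg y hy)
  have hcn := hcd.norm
  have hI : ∫ y in y1..y2, deriv g (x + y * Complex.I) * Complex.I =
      g (x + y2 * Complex.I) - g (x + y1 * Complex.I) := by
    refine intervalIntegral.integral_eq_sub_of_hasDerivAt (f := fun y : ℝ => g (x + y * Complex.I)) ?_ ?_
    · intro y hy'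
      rw [uIcc_of_le hy] at hy'
      have h1 := (hg.differentiableAt (hO.mem_nhds (hTO (hseg y hy')))).hasDerivAt
      have h2 : HasDerivAt (fun y : ℝ => (x + y * Complex.I : ℂ)) Complex.I y := by
        have := ((Complex.ofRealCLM.hasDerivAt (x := y)).mul_const Complex.I).const_add (x : ℂ)
        simpa using this
      exact h1.comp y h2
    · apply ContinuousOn.intervalIntegrable
      rw [uIcc_of_le hy]
      exact hcd.mul continuousOn_const
  set I1 := ∫ y in y1..y2, ‖deriv g (x + y * Complex.I)‖ with hI1
  set I2 := ∫ y in y1..y2, ‖deriv g (x + y * Complex.I)‖ ^ 2 with hI2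
  have hn : ‖g (x + y2 * Complex.I) - g (x + y1 * Complex.I)‖ ≤ I1 := by
    rw [← hI]
    refine (intervalIntegral.norm_integral_le_integral_norm hy).trans (le_of_eq ?_)
    simp [hI1]
  have hi1 : IntervalIntegrable (fun y : ℝ => ‖deriv g (x + y * Complex.I)‖) volume y1 y2 := by
    apply ContinuousOn.intervalIntegrable
    rwa [uIcc_of_le hy]
  have hi2 : IntervalIntegrable (fun y : ℝ => ‖deriv g (x + y * Complex.I)‖ ^ 2) volume y1 y2 := by
    apply ContinuousOn.intervalIntegrable
    rw [uIcc_of_le hy]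
    exact hcn.pow 2
  have hquad : ∀ t : ℝ, 0 ≤ I2 - 2 * t * I1 + t ^ 2 * (y2 - y1) := by
    intro t
    have h0 : 0 ≤ ∫ y in y1..y2, (‖deriv g (x + y * Complex.I)‖ - t) ^ 2 :=
      intervalIntegral.integral_nonneg hy (fun u _ => sq_nonneg _)
    have h1 : ∫ y in y1..y2, (‖deriv g (x + y * Complex.I)‖ - t) ^ 2 =
       ∫ y in y1..y2, ((‖deriv g (x + y * Complex.I)‖ ^ 2 - 2 * t * ‖deriv g (x + y * Complex.I)‖) + t ^ 2) := by
      congr 1; ext y; ring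
    rw [h1, intervalIntegral.integral_add (hi2.sub (hi1.const_mul _)) (by simp),
      intervalIntegral.integral_sub hi2 (hi1.const_mul _), intervalIntegral.integral_const_mul] at h0
    simp at h0
    linarith
  have hCS : I1 ^ 2 ≤ (y2 - y1) * I2 := by
    rcases hy.eq_or_lt with heq | hlt
    · subst heq; simp [hI1]
    · have hp : 0 < y2 - y1 := sub_pos.2 hlt
      have := hquad (I1 / (y2 - y1))
      have h3 : I2 - 2 * (I1 / (y2 - y1)) * I1 + (I1 / (y2 - y1)) ^ 2 * (y2 - y1) = I2 - I1 ^ 2 / (y2 - y1) := by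
        field_simp; ring
      rw [h3, sub_nonneg, div_le_iff₀ hp] at this
      linarith
  have hI2A : I2 ≤ A / (x1 - x0) := by
    rw [← ENNReal.ofReal_le_ofReal_iff (by positivity)]
    refine le_trans ?_ hxA
    rw [hI2, intervalIntegral.integral_of_le hy, ofReal_integral_eq_lintegral_ofReal]
    · rw [hh, ← lintegral_indicator measurableSet_Ioc]
      refine lintegral_mono fun y => ?_
      by_cases hyy : y ∈ Ioc y1 y2
      · have := hseg y (Ioc_subset_Icc_self hyy)
        simp [hyy, this, hF]
      · simp [hyy]
    · exact (intervalIntegrable_iff_integrableOn_Ioc_of_le hy).1 hi2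
    · exact Eventually.of_forall fun y => by positivity
  calc _ ≤ I1 ^ 2 := by gcongr
    _ ≤ _ := hCS
    _ ≤ _ := by
      have : 0 ≤ y2 - y1 := sub_nonneg.2 hy
      gcongr

lemma aux_polar {f : ℂ → ℂ} {W : Set ℂ} (hW : IsOpen W) (hf : DifferentiableOn ℂ f W)
    (hinj : InjOn f W) {c u : ℂ} (hu : ‖u‖ = 1) {a b : ℝ} (ha : 0 < a) (hab : a < b) {A : ℝ}
    (hA0 : 0 ≤ A) (hA : volume (f '' (W ∩ {z | dist z c < b})) ≤ ENNReal.ofReal A) :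
    ∃ r ∈ Ioo a b, ∀ y1 y2 : ℝ, y1 ≤ y2 → y1 ∈ Ioc (-Real.pi) Real.pi → y2 ∈ Ioc (-Real.pi) Real.pi →
      (∀ y ∈ Icc y1 y2, c - u * (r * Complex.exp (y * Complex.I)) ∈ W) →
      ‖f (c - u * (r * Complex.exp (y2 * Complex.I))) - f (c - u * (r * Complex.exp (y1 * Complex.I)))‖ ^ 2
        ≤ 2 * Real.pi * (A / Real.log (b / a)) := by
  have hb : 0 < b := ha.trans hab
  have hu0 : u ≠ 0 := by intro h; simp [h] at hu
  let k : ℂ → ℂ := fun w => c - u * Complex.exp w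
  have hk : Differentiable ℂ k := by fun_prop
  let O : Set ℂ := k ⁻¹' W
  let T : Set ℂ := {w | w.re < Real.log b ∧ w.im ∈ Ioc (-Real.pi) Real.pi ∧ k w ∈ W}
  have hO : IsOpen O := hW.preimage hk.continuous
  have hTm : MeasurableSet T := by
    refine (measurableSet_lt Complex.measurable_re measurable_const).inter (MeasurableSet.inter ?_ hO.measurableSet)
    exact measurableSet_Ioc.preimage Complex.measurable_im
  have hl : Real.log a < Real.log b := Real.log_lt_log ha hab
  obtain ⟨x, hx, h⟩ := aux_LA (g := f ∘ k) (O := O) (T := T) hO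
    (hf.comp hk.differentiableOn (fun w hw => hw)) (fun w hw => hw.2.2) hTm (by
      intro w1 h1 w2 h2 h12
      have := hinj h1.2.2 h2.2.2 h12
      simp only [k, sub_right_inj, mul_eq_mul_left_iff, hu0, or_false] at this
      exact Complex.exp_inj_of_neg_pi_lt_of_le_pi h1.2.1.1 h1.2.1.2 h2.2.1.1 h2.2.1.2 this)
    hl hA0 (by
      refine (measure_mono ?_).trans hA
      rw [image_comp]
      refine image_mono ?_
      rintro _ ⟨w, hw, rfl⟩
      refine ⟨hw.2.2, ?_⟩
      simp only [k, mem_ofPred_eq, dist_eq_norm]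
      rw [show c - u * Complex.exp w - c = -(u * Complex.exp w) by ring, norm_neg, norm_mul, hu, one_mul,
        Complex.norm_exp, ← Real.lt_log_iff_exp_lt hb]
      exact hw.1)
  have hk' : ∀ y : ℝ, k (x + y * Complex.I) = c - u * ((Real.exp x : ℝ) * Complex.exp (y * Complex.I)) := by
    intro y
    simp only [k]
    rw [Complex.exp_add, Complex.ofReal_exp]
  refine ⟨Real.exp x, ⟨(Real.log_lt_iff_lt_exp ha).1 hx.1, (Real.lt_log_iff_exp_lt hb).1 hx.2⟩, ?_⟩
  intro y1 y2 hy h1 h2 hseg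
  have := h y1 y2 hy (by
    intro y hyy
    refine ⟨by simpa using hx.2, by simpa using ⟨h1.1.trans_le hyy.1, hyy.2.trans h2.2⟩, ?_⟩
    rw [hk']
    exact hseg y hyy)
  simp only [Function.comp, hk'] at this
  refine this.trans ?_
  rw [Real.log_div hb.ne' ha.ne']
  have : 0 < Real.log b - Real.log a := sub_pos.2 hl
  gcongr
  linarith [h1.1, h2.2]

lemma aux_param {c u p : ℂ} (hu : ‖u‖ = 1) {r : ℝ} (hp : dist p c = r) :
    ∃ y ∈ Ioc (-Real.pi) Real.pi, p = c - u * (r * Complex.exp (y * Complex.I)) := by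
  have hu0 : u ≠ 0 := by intro h; simp [h] at hu
  refine ⟨Complex.arg ((c - p) / u), Complex.arg_mem_Ioc _, ?_⟩
  have : ‖(c - p) / u‖ = r := by rw [norm_div, hu, div_one, ← dist_eq_norm, dist_comm, hp]
  rw [← this, Complex.norm_mul_exp_arg_mul_I]
  field_simp
  ring

lemma aux_circle {f : ℂ → ℂ} {W : Set ℂ} (hW : IsOpen W) (hf : DifferentiableOn ℂ f W)
    (hinj : InjOn f W) {c : ℂ} {a b : ℝ} (ha : 0 < a) (hab : a < b) {A : ℝ}
    (hA0 : 0 ≤ A) (hA : volume (f '' W) ≤ ENNReal.ofReal A) (hb : ball c b ⊆ W) {η : ℝ} (hη : 0 ≤ η)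
    (hAη : 2 * Real.pi * (A / Real.log (b / a)) ≤ η ^ 2) :
    ∀ z ∈ closedBall c a, ‖f z - f c‖ ≤ 2 * η := by
  obtain ⟨r, hr, h⟩ := aux_polar hW hf hinj (c := c) (u := 1) (by simp) ha hab hA0
    ((measure_mono (image_mono inter_subset_left)).trans hA)
  have hr0 : 0 < r := ha.trans hr.1
  have hsph : ∀ p ∈ sphere c r, ∀ q ∈ sphere c r, ‖f p - f q‖ ≤ η := by
    intro p hp q hq
    have hu : ‖(1 : ℂ)‖ = 1 := by simp
    obtain ⟨y1, hy1, e1⟩ := aux_param hu hp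
    obtain ⟨y2, hy2, e2⟩ := aux_param hu hq
    have hin : ∀ y : ℝ, c - 1 * (r * Complex.exp (y * Complex.I)) ∈ W := by
      intro y
      apply hb
      simp [Complex.norm_exp_ofReal_mul_I, abs_of_pos hr0, hr.2]
    rw [← abs_of_nonneg hη, ← abs_of_nonneg (norm_nonneg _), ← sq_le_sq]
    refine le_trans ?_ hAη
    rcases le_total y1 y2 with hy | hy
    · rw [norm_sub_rev, e1, e2]
      exact h y1 y2 hy hy1 hy2 fun y _ => hin y
    · rw [e1, e2]
      exact h y2 y1 hy hy2 hy1 fun y _ => hin y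
  have hp0 : c + r ∈ sphere c r := by simp [abs_of_pos hr0]
  have hsub : closedBall c r ⊆ W := (closedBall_subset_ball hr.2).trans hb
  have hmax : ∀ z ∈ closedBall c r, ‖f z - f (c + r)‖ ≤ η := by
    intro z hz
    refine Complex.norm_le_of_forall_mem_frontier_norm_le (U := ball c r) (f := fun z => f z - f (c + r))
      isBounded_ball ?_ ?_ (by rwa [closure_ball _ hr0.ne'])
    · apply DifferentiableOn.diffContOnCl
      rw [closure_ball _ hr0.ne']
      exact (hf.mono hsub).sub_const _
    · intro w hw
      rw [frontier_ball _ hr0.ne'] at hw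
      exact hsph w hw _ hp0
  intro z hz
  have h1 := hmax z (closedBall_subset_closedBall hr.1.le hz)
  have h2 := hmax c (mem_closedBall_self hr0.le)
  calc ‖f z - f c‖ = ‖(f z - f (c + r)) - (f c - f (c + r))‖ := by congr 1; ring
    _ ≤ _ := norm_sub_le _ _
    _ ≤ _ := by linarith

lemma aux_arc_mem {ζ : ℂ} (hζ : ‖ζ‖ = 1) {r : ℝ} (hr : 0 < r) (y : ℝ) :
    ζ - ζ * (r * Complex.exp (y * Complex.I)) ∈ ball (0 : ℂ) 1 ↔ r / 2 < Real.cos y := by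
  have e : ζ - ζ * (r * Complex.exp (y * Complex.I)) = ζ * (1 - r * Complex.exp (y * Complex.I)) := by ring
  rw [mem_ball_zero_iff, e, norm_mul, hζ, one_mul]
  have h2 : ‖(1 - r * Complex.exp (y * Complex.I) : ℂ)‖ ^ 2 = 1 - 2 * r * Real.cos y + r ^ 2 := by
    rw [← Complex.normSq_eq_norm_sq, Complex.exp_mul_I, Complex.normSq_apply]
    simp [← Complex.ofReal_cos, ← Complex.ofReal_sin]
    nlinarith [Real.sin_sq_add_cos_sq y]
  rw [← abs_of_nonneg (norm_nonneg (1 - r * Complex.exp (y * Complex.I) : ℂ)), ← sq_lt_one_iff_abs_lt_one, h2]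
  constructor
  · intro h
    nlinarith
  · intro h
    nlinarith

lemma aux_arc {f : ℂ → ℂ} {ζ : ℂ} (hζ : ‖ζ‖ = 1) {a b : ℝ} {W : Set ℂ} (hWdef : W = ball (0 : ℂ) 1 ∩ ball ζ b)
    (hf : DifferentiableOn ℂ f W)
    (hinj : InjOn f W) (ha : 0 < a) (hab : a < b) {A : ℝ}
    (hA0 : 0 ≤ A) (hA : volume (f '' W) ≤ ENNReal.ofReal A) {η : ℝ} (hη : 0 ≤ η)
    (hAη : 2 * Real.pi * (A / Real.log (b / a)) ≤ η ^ 2) :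
    ∃ r ∈ Ioo a b, ∀ p q : ℂ, ‖p‖ < 1 → ‖q‖ < 1 → dist p ζ = r → dist q ζ = r → ‖f p - f q‖ ≤ η := by
  have hW : IsOpen W := hWdef ▸ isOpen_ball.inter isOpen_ball
  obtain ⟨r, hr, h⟩ := aux_polar hW hf hinj (c := ζ) (u := ζ) hζ ha hab hA0
    ((measure_mono (image_mono inter_subset_left)).trans hA)
  have hr0 : 0 < r := ha.trans hr.1
  refine ⟨r, hr, fun p q hp hq hpr hqr => ?_⟩
  obtain ⟨y1, hy1, e1⟩ := aux_param hζ hpr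
  obtain ⟨y2, hy2, e2⟩ := aux_param hζ hqr
  have c1 : r / 2 < Real.cos y1 := by
    rw [← aux_arc_mem hζ hr0, ← e1]; simpa using hp
  have c2 : r / 2 < Real.cos y2 := by
    rw [← aux_arc_mem hζ hr0, ← e2]; simpa using hq
  have hin : ∀ s t y : ℝ, s ∈ Ioc (-Real.pi) Real.pi → t ∈ Ioc (-Real.pi) Real.pi →
      r / 2 < Real.cos s → r / 2 < Real.cos t → y ∈ Icc s t →
      ζ - ζ * (r * Complex.exp (y * Complex.I)) ∈ W := by
    intro s t y hs ht hcs hct hy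
    rw [hWdef]
    refine ⟨?_, ?_⟩
    · rw [aux_arc_mem hζ hr0]
      rcases le_total 0 y with h0 | h0
      · exact hct.trans_le (Real.cos_le_cos_of_nonneg_of_le_pi h0 ht.2 hy.2)
      · refine hcs.trans_le ?_
        rw [← Real.cos_neg s, ← Real.cos_neg y]
        exact Real.cos_le_cos_of_nonneg_of_le_pi (by linarith) (by linarith [hs.1]) (by linarith [hy.1])
    · simp [Complex.norm_exp_ofReal_mul_I, abs_of_pos hr0, hr.2, hζ]
  rw [← abs_of_nonneg hη, ← abs_of_nonneg (norm_nonneg _), ← sq_le_sq]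
  refine le_trans ?_ hAη
  rcases le_total y1 y2 with hy | hy
  · rw [norm_sub_rev, e1, e2]
    exact h y1 y2 hy hy1 hy2 fun y hyy => hin y1 y2 y hy1 hy2 c1 c2 hyy
  · rw [e1, e2]
    exact h y2 y1 hy hy2 hy1 fun y hyy => hin y2 y1 y hy2 hy1 c2 c1 hyy

lemma aux_main_analytic {f : ℂ → ℂ} {ζ : ℂ} (hζ : ‖ζ‖ = 1) {r0 : ℝ} (hr0 : 0 < r0)
    (hf : DifferentiableOn ℂ f (ball (0 : ℂ) 1 ∩ ball ζ r0))
    (hinj : InjOn f (ball (0 : ℂ) 1 ∩ ball ζ r0))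
    (hbd : Bornology.IsBounded (f '' (ball (0 : ℂ) 1 ∩ ball ζ r0))) {η : ℝ} (hη : 0 < η) :
    ∃ s0 > 0, ∀ s, 0 < s → s < s0 → ∃ r ∈ Ioo s (5 / 4 * s), ∀ p : ℂ, ‖p‖ < 1 → dist p ζ = r →
      ‖f p - f ((1 - s) * ζ)‖ ≤ η := by
  set W : Set ℂ := ball (0 : ℂ) 1 ∩ ball ζ r0 with hWd
  have hlog : 0 < Real.log (5 / 4) := Real.log_pos (by norm_num)
  have hlog2 : Real.log (5 / 4) ≤ Real.log 2 := Real.log_le_log (by norm_num) (by norm_num)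
  obtain ⟨A, hA0, hA⟩ : ∃ A : ℝ, 0 < A ∧ 2 * Real.pi * (A / Real.log (5 / 4)) = (η / 3) ^ 2 := by
    refine ⟨(η / 3) ^ 2 * Real.log (5 / 4) / (2 * Real.pi), by positivity, ?_⟩
    field_simp
  have hA2 : 2 * Real.pi * (A / Real.log 2) ≤ (η / 3) ^ 2 := by
    rw [← hA]; gcongr
  -- small area
  have hWr : ∀ r, IsOpen (ball (0 : ℂ) 1 ∩ ball ζ r) := fun r => isOpen_ball.inter isOpen_ball
  have hsmall : ∃ r1 > 0, r1 ≤ r0 ∧ volume (f '' (ball (0 : ℂ) 1 ∩ ball ζ r1)) ≤ ENNReal.ofReal A := by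
    have hsub : ∀ n : ℕ, ball (0 : ℂ) 1 ∩ ball ζ (r0 / (n + 1)) ⊆ W := fun n => by
      refine inter_subset_inter_right _ (ball_subset_ball ?_)
      apply div_le_self hr0.le
      have : (0:ℝ) ≤ n := n.cast_nonneg
      linarith
    have hmeas : ∀ n : ℕ, MeasurableSet (f '' (ball (0 : ℂ) 1 ∩ ball ζ (r0 / (n + 1)))) := fun n =>
      (hWr _).measurableSet.image_of_continuousOn_injOn (hf.continuousOn.mono (hsub n)) (hinj.mono (hsub n))
    have hanti : Antitone fun n : ℕ => f '' (ball (0 : ℂ) 1 ∩ ball ζ (r0 / (n + 1))) := by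
      intro m n hmn
      refine image_mono (inter_subset_inter_right _ (ball_subset_ball ?_))
      gcongr
    have hlim := tendsto_measure_iInter_atTop (μ := volume) (fun n => (hmeas n).nullMeasurableSet) hanti
      ⟨0, ((hbd.subset (image_mono (hsub 0))).measure_lt_top).ne⟩
    have hempty : ⋂ n : ℕ, f '' (ball (0 : ℂ) 1 ∩ ball ζ (r0 / (n + 1))) = ∅ := by
      rw [eq_empty_iff_forall_notMem]
      intro z hz
      rw [mem_iInter] at hz
      obtain ⟨w, hw, hwz⟩ := hz 0
      have hall : ∀ n : ℕ, dist w ζ < r0 / (n + 1) := by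
        intro n
        obtain ⟨w', hw', hwz'⟩ := hz n
        have : w = w' := hinj (hsub 0 hw) (hsub n hw') (hwz.trans hwz'.symm)
        rw [this]; exact hw'.2
      have hne : 0 < dist w ζ := by
        rw [dist_pos]
        intro h
        have := hw.1
        rw [h, mem_ball_zero_iff, hζ] at this
        exact lt_irrefl _ this
      obtain ⟨n, hn⟩ := exists_nat_gt (r0 / dist w ζ)
      have := hall n
      rw [lt_div_iff₀ (by positivity)] at this
      rw [div_lt_iff₀ hne] at hn
      nlinarith
    rw [hempty, measure_empty] at hlim
    obtain ⟨n, hn⟩ := (hlim.eventually_le_const (ENNReal.ofReal_pos.2 hA0)).exists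
    refine ⟨r0 / (n + 1), by positivity, ?_, hn⟩
    apply div_le_self hr0.le
    have : (0:ℝ) ≤ n := n.cast_nonneg
    linarith
  obtain ⟨r1, hr1, hr10, hvol⟩ := hsmall
  refine ⟨min (r1 / 2) (1 / 2), by positivity, fun s hs hs0 => ?_⟩
  have hs1 : s < r1 / 2 := hs0.trans_le (min_le_left _ _)
  have hs2 : s < 1 / 2 := hs0.trans_le (min_le_right _ _)
  have sub1 : ball (0 : ℂ) 1 ∩ ball ζ (5 / 4 * s) ⊆ ball (0 : ℂ) 1 ∩ ball ζ r1 :=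
    inter_subset_inter_right _ (ball_subset_ball (by linarith))
  have sub2 : ball (0 : ℂ) 1 ∩ ball ζ r1 ⊆ W := inter_subset_inter_right _ (ball_subset_ball hr10)
  obtain ⟨r, hr, h⟩ := aux_arc (f := f) hζ (a := s) (b := 5 / 4 * s) rfl (hf.mono (sub1.trans sub2))
    (hinj.mono (sub1.trans sub2)) hs (by linarith) hA0.le ((measure_mono (image_mono sub1)).trans hvol)
    (η := η / 3) (by positivity) (by rw [mul_div_assoc, div_self hs.ne', mul_one, hA])
  have hcirc := aux_circle (c := (1 - s) * ζ) (a := s / 4) (b := s / 2) (hWr r1) (hf.mono sub2) (hinj.mono sub2)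
    (by positivity) (by linarith) hA0.le hvol (by
      intro z hz
      rw [mem_ball] at hz
      have n1 : ‖((1 - s) * ζ : ℂ)‖ = 1 - s := by
        rw [norm_mul, hζ, mul_one, ← Complex.ofReal_one, ← Complex.ofReal_sub, Complex.norm_real, Real.norm_eq_abs,
          abs_of_pos (by linarith)]
      have n2 : dist ((1 - s) * ζ : ℂ) ζ = s := by
        rw [dist_eq_norm, show ((1 - s) * ζ - ζ : ℂ) = -(s * ζ) by ring, norm_neg, norm_mul, hζ, mul_one,
          Complex.norm_real, Real.norm_eq_abs, abs_of_pos hs]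
      refine ⟨?_, ?_⟩
      · rw [mem_ball]
        have := dist_triangle z ((1 - s) * ζ) 0
        rw [dist_zero_right ((1 - s) * ζ : ℂ), n1] at this
        linarith
      · rw [mem_ball]
        have := dist_triangle z ((1 - s) * ζ) ζ
        linarith) (η := η / 3) (by positivity) (by
      rwa [show s / 2 / (s / 4) = 2 by field_simp; norm_num])
  refine ⟨r, hr, fun p hp hpr => ?_⟩
  have hr0' : 0 < r := hs.trans hr.1
  have hr1' : r < 1 := by linarith [hr.2]
  have h1 := h p ((1 - r) * ζ) hp (by
      rw [norm_mul, hζ, mul_one, ← Complex.ofReal_one, ← Complex.ofReal_sub, Complex.norm_real, Real.norm_eq_abs,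
          abs_of_pos (by linarith)]; linarith) hpr (by
      rw [dist_eq_norm, show ((1 - r) * ζ - ζ : ℂ) = -(r * ζ) by ring, norm_neg, norm_mul, hζ, mul_one,
          Complex.norm_real, Real.norm_eq_abs, abs_of_pos hr0'])
  have h2 := hcirc ((1 - r) * ζ) (by
      rw [mem_closedBall, dist_eq_norm, show ((1 - r) * ζ - (1 - s) * ζ : ℂ) = -(((r - s : ℝ) : ℂ) * ζ) by
        push_cast; ring, norm_neg, norm_mul, hζ, mul_one,
        Complex.norm_real, Real.norm_eq_abs, abs_of_pos (by linarith [hr.1])]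
      linarith [hr.2])
  calc ‖f p - f ((1 - s) * ζ)‖ = ‖(f p - f ((1 - r) * ζ)) + (f ((1 - r) * ζ) - f ((1 - s) * ζ))‖ := by congr 1; ring
    _ ≤ _ := norm_add_le _ _
    _ ≤ _ := by linarith

end aux

lemma aux_hol {φ : ℂ → OnePoint ℂ} {D : Set ℂ} (h : HolomorphicIntoSphereOn φ D) {f : ℂ → ℂ} {z : ℂ}
    (hz : z ∈ D) (hf : ∀ᶠ w in 𝓝 z, φ w = (f w : OnePoint ℂ)) : DifferentiableAt ℂ f z := by
  rcases h z hz with ⟨g, hg, he⟩ | ⟨g, hg, he⟩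
  · refine hg.differentiableAt.congr_of_eventuallyEq ?_
    filter_upwards [hf, he] with w h1 h2
    rw [h1] at h2
    exact OnePoint.coe_injective h2
  · have h0 : g z ≠ 0 := by
      intro h0
      have h1 := hf.self_of_nhds
      have h2 := he.self_of_nhds
      rw [if_pos h0, h1] at h2
      exact OnePoint.coe_ne_infty _ h2
    refine (hg.differentiableAt.inv h0).congr_of_eventuallyEq ?_
    filter_upwards [hf, he] with w h1 h2
    rw [h1] at h2
    split_ifs at h2 with h3
    · exact absurd h2 (OnePoint.coe_ne_infty _)
    · exact OnePoint.coe_injective h2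

/-- If `K` is locally connected at a principal point `z₀` of the prime end `ζ`, then
the impression of `ζ` is trivial: `I(ζ) = {z₀}`. -/
theorem stmt5
    (U : Set ℂ∞) (hUopen : IsOpen U) (hUconn : IsConnected U)
    (hUsc : SimplyConnectedSpace U) (hinfty : ∞ ∈ U)
    (hKconn : IsConnected Uᶜ) (hKnt : Set.Nontrivial Uᶜ)
    (φ : ℂ → ℂ∞) (ψ : ℂ∞ → ℂ)
    (hφcont : ContinuousOn φ (ball (0 : ℂ) 1))
    (hφmaps : MapsTo φ (ball (0 : ℂ) 1) U)
    (hφhol : HolomorphicIntoSphereOn φ (ball (0 : ℂ) 1))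
    (hψcont : ContinuousOn ψ U)
    (hψmaps : MapsTo ψ U (ball (0 : ℂ) 1))
    (hψφ : ∀ z ∈ ball (0 : ℂ) 1, ψ (φ z) = z)
    (hφψ : ∀ w ∈ U, φ (ψ w) = w)
    (ζ : ℂ) (hζ : ζ ∈ sphere (0 : ℂ) 1)
    (z₀ : ℂ∞) (hz₀ : z₀ ∈ principalPoints φ ζ)
    (hlc : LocallyConnectedAt Uᶜ z₀) :
    impression φ ζ = {z₀} := by
  have hζ1 : ‖ζ‖ = 1 := by simpa using hζ
  obtain ⟨t, ht, htlim, htφ⟩ := hz₀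
  have hpt : ∀ j, (t j : ℂ) * ζ ∈ ball (0 : ℂ) 1 := by
    intro j
    rw [mem_ball_zero_iff, norm_mul, hζ1, mul_one, Complex.norm_real, Real.norm_eq_abs, abs_of_nonneg (ht j).1]
    exact (ht j).2
  have hptlim : Tendsto (fun j => (t j : ℂ) * ζ) atTop (𝓝 ζ) := by
    have : Tendsto (fun j => (t j : ℂ)) atTop (𝓝 ((1 : ℝ) : ℂ)) :=
      (Complex.continuous_ofReal.tendsto 1).comp htlim
    simpa using this.mul_const ζ
  -- `z₀` is not in `U`
  have hz₀U : z₀ ∉ U := by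
    intro h
    have h1 : Tendsto (fun j => ψ (φ ((t j : ℂ) * ζ))) atTop (𝓝 (ψ z₀)) :=
      ((hψcont.continuousAt (hUopen.mem_nhds h)).tendsto).comp htφ
    have h2 : (fun j => ψ (φ ((t j : ℂ) * ζ))) = fun j => (t j : ℂ) * ζ := by
      ext j; exact hψφ _ (hpt j)
    rw [h2] at h1
    have h3 := tendsto_nhds_unique h1 hptlim
    have h4 := hψmaps h
    rw [h3, mem_ball_zero_iff, hζ1] at h4
    exact lt_irrefl _ h4
  obtain ⟨c, rfl⟩ : ∃ c : ℂ, (c : OnePoint ℂ) = z₀ :=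
    OnePoint.ne_infty_iff_exists.1 (fun h => hz₀U (h ▸ hinfty))
  -- finite part
  let f : ℂ → ℂ := fun w => (φ w).elim 0 id
  have hfφ : ∀ w, φ w ≠ ∞ → φ w = (f w : OnePoint ℂ) := by
    intro w hw
    obtain ⟨y, hy⟩ := OnePoint.ne_infty_iff_exists.1 hw
    simp only [f, ← hy, OnePoint.elim_some, id]
  have hdpos : 0 < dist (ψ ∞) ζ := by
    rw [dist_pos]
    intro h
    have h4 := hψmaps hinfty
    rw [h, mem_ball_zero_iff, hζ1] at h4
    exact lt_irrefl _ h4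
  set r0 := dist (ψ ∞) ζ / 2 with hr0d
  have hr0 : 0 < r0 := by positivity
  set W : Set ℂ := ball (0 : ℂ) 1 ∩ ball ζ r0 with hWd
  have hWo : IsOpen W := isOpen_ball.inter isOpen_ball
  have hWφ : ∀ w ∈ W, φ w = (f w : OnePoint ℂ) := by
    intro w hw
    apply hfφ
    intro h
    have h1 := hψφ w hw.1
    rw [h] at h1
    have := hw.2
    rw [mem_ball, ← h1] at this
    linarith
  have hfd : DifferentiableOn ℂ f W := by
    intro w hw
    refine (aux_hol hφhol hw.1 ?_).differentiableWithinAt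
    filter_upwards [hWo.mem_nhds hw] with v hv using hWφ v hv
  have hfinj : InjOn f W := by
    intro a ha b hb hab
    rw [← hψφ a ha.1, ← hψφ b hb.1, hWφ a ha, hWφ b hb, hab]
  have hfb : Bornology.IsBounded (f '' W) := by
    have hO : IsOpen (U ∩ ψ ⁻¹' (ball (ψ ∞) r0)) := hψcont.isOpen_inter_preimage hUopen isOpen_ball
    have := ((OnePoint.isOpen_iff_of_mem (by exact ⟨hinfty, mem_ball_self hr0⟩)).1 hO).2.isBounded
    refine this.subset ?_
    rintro _ ⟨w, hw, rfl⟩ ⟨_, h2⟩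
    rw [← hWφ w hw, mem_preimage, hψφ w hw.1, mem_ball] at h2
    have h3 := hw.2
    rw [mem_ball] at h3
    have := dist_triangle_left (ψ ∞) ζ w
    linarith
  set K : Set ℂ := {z : ℂ | (z : OnePoint ℂ) ∉ U} with hKd
  have hKcl : IsClosed K := ((OnePoint.isOpen_iff_of_mem hinfty).1 hUopen).1
  have hψc : ContinuousOn (fun z : ℂ => ψ (z : OnePoint ℂ)) Kᶜ :=
    hψcont.comp OnePoint.continuous_coe.continuousOn (fun z hz => not_not.1 hz)
  -- the key claim
  have key : ∀ ε > 0, ∃ r > 0, r < r0 ∧ ∀ w ∈ ball (0 : ℂ) 1 ∩ ball ζ r, dist (f w) c ≤ ε := by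
    intro ε hε
    obtain ⟨M, hM, hMs, hMc⟩ := hlc ((↑) '' (closedBall c ε)) (mem_nhdsWithin_of_mem_nhds (by
      rw [OnePoint.nhds_coe_eq]
      exact image_mem_map (closedBall_mem_nhds c hε)))
    let N0 : Set ℂ := (↑) ⁻¹' M
    have hN0img : ((↑) '' N0 : Set (OnePoint ℂ)) = M := by
      rw [image_preimage_eq_iff]
      intro x hx
      obtain ⟨y, _, hy⟩ := (hMs hx).2
      exact ⟨y, hy⟩
    have hN0c : IsPreconnected N0 := by
      rw [← OnePoint.isOpenEmbedding_coe.isInducing.isPreconnected_image, hN0img]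
      exact hMc.isPreconnected
    have hN0K : N0 ⊆ K := fun x hx => (hMs hx).1
    have hN0ε : N0 ⊆ closedBall c ε := by
      intro x hx
      obtain ⟨y, hy, hyx⟩ := (hMs hx).2
      rwa [← OnePoint.coe_injective hyx]
    obtain ⟨δ, hδ, hδN⟩ : ∃ δ > 0, ball c δ ∩ K ⊆ N0 := by
      rw [OnePoint.nhdsWithin_coe, mem_map] at hM
      exact Metric.mem_nhdsWithin_iff.1 hM
    set δ' := min (δ / 2) ε with hδ'
    have hδ'0 : 0 < δ' := by positivity
    have hδ'1 : δ' < δ := (min_le_left _ _).trans_lt (by linarith)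
    have hδ'2 : δ' ≤ ε := min_le_right _ _
    obtain ⟨s0, hs0, hs⟩ := aux_main_analytic hζ1 hr0 hfd hfinj hfb (η := δ' / 2) (by positivity)
    -- choose j
    have hev1 : ∀ᶠ j in atTop, 1 - t j < min s0 (r0 / 2) := by
      have : Tendsto (fun j => 1 - t j) atTop (𝓝 (1 - 1)) := tendsto_const_nhds.sub htlim
      rw [sub_self] at this
      exact this.eventually_lt_const (by positivity)
    have hev2 : ∀ᶠ j in atTop, φ ((t j : ℂ) * ζ) ∈ ((↑) '' (ball c (δ' / 2)) : Set (OnePoint ℂ)) :=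
      htφ (by
        rw [OnePoint.nhds_coe_eq]
        exact image_mem_map (ball_mem_nhds c (by positivity)))
    obtain ⟨j, hj1, y, hy, hjy⟩ := (hev1.and hev2).exists
    have hfy : f ((t j : ℂ) * ζ) = y := by
      simp only [f, ← hjy, OnePoint.elim_some, id]
    obtain ⟨r, hr, hrf⟩ := hs (1 - t j) (by linarith [(ht j).2]) (hj1.trans_le (min_le_left _ _))
    have hj2 := hj1.trans_le (min_le_right _ _)
    have htj := (ht j).2
    have hrpos : 0 < r := by linarith [hr.1]
    have hrr0 : r < r0 := by linarith [hr.2]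
    have harc : ∀ p : ℂ, ‖p‖ < 1 → dist p ζ = r → dist (f p) c ≤ δ' := by
      intro p hp hpr
      have h1 := hrf p hp hpr
      rw [show ((1 - ((1 - t j : ℝ) : ℂ)) * ζ : ℂ) = (t j : ℂ) * ζ by push_cast; ring, hfy, ← dist_eq_norm] at h1
      rw [mem_ball] at hy
      have := dist_triangle (f p) y c
      linarith
    refine ⟨r, hrpos, hrr0, ?_⟩
    intro w hw
    by_contra hcon
    rw [not_le] at hcon
    let V : Set ℂ := Kᶜ ∩ (fun z : ℂ => ψ (z : OnePoint ℂ)) ⁻¹' (ball ζ r)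
    have hVo : IsOpen V := hψc.isOpen_inter_preimage hKcl.isOpen_compl isOpen_ball
    have hVf : ∀ z ∈ Kᶜ, dist (ψ (z : OnePoint ℂ)) ζ < r0 →
        ψ (z : OnePoint ℂ) ∈ W ∧ f (ψ (z : OnePoint ℂ)) = z := by
      intro z hz hzr
      have hzU : (z : OnePoint ℂ) ∈ U := not_not.1 hz
      have hzW : ψ (z : OnePoint ℂ) ∈ W := ⟨hψmaps hzU, hzr⟩
      refine ⟨hzW, ?_⟩
      have := hWφ _ hzW
      rw [hφψ _ hzU] at this
      exact (OnePoint.coe_injective this).symm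
    have hVb : Bornology.IsBounded V := by
      refine hfb.subset ?_
      rintro z ⟨hz, hzr⟩
      obtain ⟨h1, h2⟩ := hVf z hz ((mem_ball.1 hzr).trans hrr0)
      exact ⟨_, h1, h2⟩
    let Γ : Set ℂ := f '' {p | ‖p‖ < 1 ∧ dist p ζ = r}
    have hΓ : Γ ⊆ closedBall c δ' := by
      rintro _ ⟨p, hp, rfl⟩
      exact harc p hp.1 hp.2
    have hfr : frontier V ⊆ K ∪ Γ := by
      intro z hz
      by_cases hzK : z ∈ K
      · exact Or.inl hzK
      · right
        have hzU : (z : OnePoint ℂ) ∈ U := not_not.1 hzK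
        have hzV : z ∉ V := by
          rw [hVo.frontier_eq] at hz; exact hz.2
        have h1 : r ≤ dist (ψ (z : OnePoint ℂ)) ζ := by
          by_contra h
          exact hzV ⟨hzK, mem_ball.2 (not_le.1 h)⟩
        have h2 : dist (ψ (z : OnePoint ℂ)) ζ ≤ r := by
          by_contra h
          have hO : IsOpen (Kᶜ ∩ (fun z : ℂ => ψ (z : OnePoint ℂ)) ⁻¹' (closedBall ζ r)ᶜ) :=
            hψc.isOpen_inter_preimage hKcl.isOpen_compl isClosed_closedBall.isOpen_compl
          obtain ⟨v, hv1, hv2⟩ := mem_closure_iff.1 (frontier_subset_closure hz) _ hO ⟨hzK, h⟩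
          exact hv1.2 (ball_subset_closedBall hv2.2)
        have h3 := le_antisymm h2 h1
        obtain ⟨h4, h5⟩ := hVf z hzK (h3 ▸ hrr0)
        exact ⟨_, ⟨by simpa using h4.1, h3⟩, h5⟩
    have hwW : w ∈ W := ⟨hw.1, ball_subset_ball hrr0.le hw.2⟩
    have hfwU : (f w : OnePoint ℂ) ∈ U := by rw [← hWφ w hwW]; exact hφmaps hw.1
    have hfwV : f w ∈ V := by
      refine ⟨not_not.2 hfwU, ?_⟩
      rw [mem_preimage, ← hWφ w hwW, hψφ w hw.1]
      exact hw.2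
    obtain ⟨l, hl, hl1⟩ := aux_logK hUopen hUconn.isPreconnected hinfty hfwU
    have hcN : c ∈ N0 := hδN ⟨mem_ball_self hδ, hz₀U⟩
    refine aux_sep (N := closure N0) hKcl hVo hVb hfr isClosed_closure hN0c.closure
      (closure_minimal hN0K hKcl) (subset_closure hcN) (ε := ε)
      (hΓ.trans (closedBall_subset_closedBall hδ'2)) (closure_minimal hN0ε isClosed_closedBall) ?_
      hfwV hcon hl (fun z hz => hl1 z hz)
    rintro z ⟨hzK, hzΓ⟩
    refine subset_closure (hδN ⟨?_, hzK⟩)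
    exact closedBall_subset_ball hδ'1 (closure_minimal hΓ isClosed_closedBall hzΓ)
  -- conclusion
  ext z
  rw [mem_singleton_iff]
  constructor
  · rintro ⟨w, hw, hwlim, hwφ⟩
    refine tendsto_nhds_unique hwφ ?_
    have h1 : Tendsto (fun j => f (w j)) atTop (𝓝 c) := by
      rw [Metric.tendsto_nhds]
      intro ε hε
      obtain ⟨r, hr, _, h⟩ := key (ε / 2) (by positivity)
      filter_upwards [hwlim (ball_mem_nhds ζ hr)] with j hj
      have := h (w j) ⟨hw j, hj⟩
      linarith
    refine ((OnePoint.continuous_coe.tendsto c).comp h1).congr' ?_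
    filter_upwards [hwlim (ball_mem_nhds ζ hr0)] with j hj
    exact (hWφ (w j) ⟨hw j, hj⟩).symm
  · rintro rfl
    exact ⟨fun j => (t j : ℂ) * ζ, hpt, hptlim, htφ⟩

end
end

section
/- K is locally connected (i.e. locally connected at every point of K) if and only if every prime end impression is trivial: for every ζ ∈ ∂𝔻 the impression I(ζ) consists of a single point. -/
open Filter Topology Metric Set OnePoint

noncomputable section

local notation "ℂ∞" => OnePoint ℂ

lemma exp_eq_const {X : Type*} [TopologicalSpace X] {s : Set X} (hs : IsPreconnected s)
    {g₁ g₂ : X → ℂ} (h1 : ContinuousOn g₁ s) (h2 : ContinuousOn g₂ s)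
    (h : ∀ x ∈ s, Complex.exp (g₁ x) = Complex.exp (g₂ x)) :
    ∃ c : ℂ, Complex.exp c = 1 ∧ ∀ x ∈ s, g₁ x = g₂ x + c := by
  have key : ∀ x ∈ s, ∃ n : ℤ, g₁ x = g₂ x + n * (2 * Real.pi * Complex.I) := fun x hx =>
    Complex.exp_eq_exp_iff_exists_int.1 (h x hx)
  have hd : IsDiscrete (range ((↑) : ℤ → ℝ)) :=
    Int.isClosedEmbedding_coe_real.isInducing.isDiscrete_range
  have hc : ContinuousOn (fun x => (g₁ x - g₂ x).im / (2 * Real.pi)) s :=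
    (Complex.continuous_im.comp_continuousOn (h1.sub h2)).div_const _
  have hv : ∀ x ∈ s, ∀ n : ℤ, g₁ x = g₂ x + n * (2 * Real.pi * Complex.I) → 
     (g₁ x - g₂ x).im / (2 * Real.pi) = n := by
    intro x hx n hn
    rw [hn]
    have := Real.pi_pos
    simp
  obtain ⟨y, ⟨n, rfl⟩, hy⟩ := hs.eqOn_const_of_mapsTo (T := range ((↑) : ℤ → ℝ)) hd hc (by
    intro x hx
    obtain ⟨n, hn⟩ := key x hx
    exact ⟨n, (hv x hx n hn).symm⟩) ⟨0, 0, by simp⟩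
  refine ⟨n * (2 * Real.pi * Complex.I), Complex.exp_int_mul_two_pi_mul_I n, fun x hx => ?_⟩
  obtain ⟨m, hm⟩ := key x hx
  have h3 := hy hx
  simp only [hv x hx m hm, Function.const] at h3
  rw [hm]
  have : m = n := by exact_mod_cast h3
  rw [this]

/-- no continuous log of `exp(int)` on the circle -/
lemma no_log_circle {M : ℝ → ℂ} (hM : Continuous M) (n : ℕ) (hn : n ≠ 0)
    (hexp : ∀ t : ℝ, Complex.exp (M t) = Complex.exp (n * (t * Complex.I)))
    (hper : M (2 * Real.pi) = M 0) : False := by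
  obtain ⟨c, -, hc⟩ := exp_eq_const (s := (univ : Set ℝ)) isPreconnected_univ hM.continuousOn
    (g₂ := fun t : ℝ => (n * (t * Complex.I) : ℂ)) (by fun_prop) (fun t _ => hexp t)
  have h0 := hc 0 trivial
  have h1 := hc (2 * Real.pi) trivial
  rw [hper, h0] at h1
  have := Real.pi_ne_zero
  simp [Complex.I_ne_zero, hn] at h1

/-- no continuous log of `(z - z1)^n` on the boundary of a convex compact nbhd of `z1` -/
lemma no_log_frontier {C : Set ℂ} (hC : Convex ℝ C) (hb : Bornology.IsBounded C) {z₁ : ℂ}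
    (hz : C ∈ 𝓝 z₁) {m : ℂ → ℂ} (hm : ContinuousOn m (frontier C)) (n : ℕ) (hn : n ≠ 0)
    (hexp : ∀ z ∈ frontier C, Complex.exp (m z) = (z - z₁) ^ n) : False := by
  set S : Set ℂ := (fun z => z₁ + z) ⁻¹' C with hS
  have hSc : Convex ℝ S := hC.translate_preimage_right z₁
  have hS0 : S ∈ 𝓝 (0 : ℂ) := by
    apply (continuous_const.add continuous_id : Continuous (fun z => z₁ + z)).continuousAt.preimage_mem_nhds
    simpa using hz
  have hSb : Bornology.IsBounded S := by
    have : S = (fun z => -z₁ + z) '' C := by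
      rw [hS]; ext z; simp
    rw [this]
    exact (isometry_add_left (-z₁)).lipschitz.isBounded_image hb
  have hfr : frontier S = (fun z => z₁ + z) ⁻¹' frontier C :=
    ((Homeomorph.addLeft z₁).preimage_frontier C).symm
  have hg := continuous_gauge hSc hS0
  set e : ℝ → ℂ := fun t => Complex.exp (t * Complex.I) with he
  have hec : Continuous e := by fun_prop
  have hpos : ∀ t, 0 < gauge S (e t) := fun t =>
    (gauge_pos (absorbent_nhds_zero hS0) (NormedSpace.isVonNBounded_of_isBounded ℝ hSb)).2 (Complex.exp_ne_zero _)
  set P : ℝ → ℂ := fun t => z₁ + (gauge S (e t))⁻¹ • e t with hP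
  have hPf : ∀ t, P t ∈ frontier C := by
    intro t
    have : (gauge S (e t))⁻¹ • e t ∈ frontier S := by
      rw [← gauge_eq_one_iff_mem_frontier hSc hS0, gauge_smul_of_nonneg (inv_nonneg.2 (hpos t).le)]
      simp [(hpos t).ne']
    rw [hfr] at this
    exact this
  have hPc : Continuous P := by
    refine continuous_const.add (Continuous.smul (Continuous.inv₀ (hg.comp hec) fun t => (hpos t).ne') hec)
  refine no_log_circle (M := fun t => m (P t) + n * (Real.log (gauge S (e t)) : ℂ)) ?_ n hn ?_ ?_
  · refine (hm.comp_continuous hPc hPf).add (continuous_const.mul (Complex.continuous_ofReal.comp ?_))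
    exact Continuous.log (hg.comp hec) fun t => (hpos t).ne'
  · intro t
    rw [Complex.exp_add, hexp _ (hPf t), Complex.exp_nat_mul, Complex.exp_nat_mul, ← mul_pow, ← Complex.ofReal_exp,
      Real.exp_log (hpos t)]
    congr 1
    have : (gauge S (e t) : ℂ) ≠ 0 := by exact_mod_cast (hpos t).ne'
    simp only [hP, he, add_sub_cancel_left, Complex.real_smul, Complex.ofReal_inv]
    simp only [he] at this
    field_simp
  · have : e (2 * Real.pi) = e 0 := by simp [he]
    simp only [hP, this]

/-- `w - w₁` has a continuous logarithm near `K`. -/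
def HasLogNear (K : Set ℂ) (w₁ : ℂ) : Prop :=
  ∃ N : Set ℂ, IsOpen N ∧ K ⊆ N ∧ ∃ g : ℂ → ℂ, ContinuousOn g N ∧ ∀ w ∈ N, Complex.exp (g w) = w - w₁

lemma HasLogNear.of_close {K : Set ℂ} {w₁ w₂ : ℂ} (h : HasLogNear K w₁)
    (hd : ∀ w ∈ K, ‖w₂ - w₁‖ < ‖w - w₁‖) : HasLogNear K w₂ := by
  obtain ⟨N, hN, hKN, g, hg, hexp⟩ := h
  refine ⟨N ∩ {w | ‖w₂ - w₁‖ < ‖w - w₁‖}, hN.inter (isOpen_lt (by fun_prop) (by fun_prop)),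
    fun w hw => ⟨hKN hw, hd w hw⟩, fun w => g w + Complex.log ((w - w₂) / (w - w₁)), ?_, ?_⟩
  · refine (hg.mono inter_subset_left).add (ContinuousOn.clog ?_ ?_)
    · refine ContinuousOn.div (by fun_prop) (by fun_prop) ?_
      intro w hw h0
      have := hw.2
      simp only [mem_ofPred_eq, h0, norm_zero] at this
      exact absurd this (not_lt.2 (norm_nonneg _))
    · intro w hw
      have h2 : ‖w₂ - w₁‖ < ‖w - w₁‖ := hw.2
      have h0 : w - w₁ ≠ 0 := by
        intro h0
        rw [h0, norm_zero] at h2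
        exact absurd h2 (not_lt.2 (norm_nonneg _))
      have : (w - w₂) / (w - w₁) = 1 + (-((w₂ - w₁) / (w - w₁))) := by field_simp; ring
      rw [this]
      apply Complex.mem_slitPlane_of_norm_lt_one
      rw [norm_neg, norm_div, div_lt_one (norm_pos_iff.2 h0)]
      exact h2
  · intro w hw
    have h2 : ‖w₂ - w₁‖ < ‖w - w₁‖ := hw.2
    have h0 : w - w₁ ≠ 0 := by
      intro h0
      rw [h0, norm_zero] at h2
      exact absurd h2 (not_lt.2 (norm_nonneg _))
    have h1 : w - w₂ ≠ 0 := by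
      intro h1
      rw [sub_eq_zero.1 h1] at h2
      exact lt_irrefl _ h2
    rw [Complex.exp_add, hexp w hw.1, Complex.exp_log (div_ne_zero h1 h0)]
    field_simp

lemma HasLogNear.of_far {K : Set ℂ} {w₁ : ℂ} (hd : ∀ w ∈ K, ‖w‖ < ‖w₁‖) : HasLogNear K w₁ := by
  rcases K.eq_empty_or_nonempty with rfl | ⟨k, hk⟩
  · exact ⟨∅, isOpen_empty, by simp, 0, by simp, by simp⟩
  have h0 : w₁ ≠ 0 := by
    rw [← norm_pos_iff]
    exact (norm_nonneg _).trans_lt (hd k hk)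
  refine ⟨{w | ‖w‖ < ‖w₁‖}, isOpen_lt (by fun_prop) (by fun_prop), hd, 
    fun w => Complex.log (-w₁) + Complex.log (1 + (-(w / w₁))), ?_, ?_⟩
  · refine continuousOn_const.add (ContinuousOn.clog (by fun_prop) ?_)
    intro w hw
    apply Complex.mem_slitPlane_of_norm_lt_one
    rw [norm_neg, norm_div, div_lt_one (norm_pos_iff.2 h0)]
    exact hw
  · intro w hw
    have : (1 + (-(w / w₁))) ≠ 0 := by
      apply Complex.slitPlane_ne_zero
      apply Complex.mem_slitPlane_of_norm_lt_one
      rw [norm_neg, norm_div, div_lt_one (norm_pos_iff.2 h0)]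
      exact hw
    rw [Complex.exp_add, Complex.exp_log (neg_ne_zero.2 h0), Complex.exp_log this]
    field_simp
    ring

lemma convex_sc {s : Set ℂ} (hs : Convex ℝ s) (h : s.Nonempty) : IsSimplyConnected s := by
  have := hs.contractibleSpace h
  exact (inferInstance : SimplyConnectedSpace s)


structure CoreMap (K : Set ℂ) (f : ℂ → ℂ) (z₀ : ℂ) : Prop where
  compact : IsCompact K
  hz₀ : z₀ ∈ ball (0 : ℂ) 1
  an : ∀ z ∈ ball (0 : ℂ) 1, z ≠ z₀ → AnalyticAt ℂ f z
  inj : ∀ z ∈ ball (0 : ℂ) 1, z ≠ z₀ → ∀ z' ∈ ball (0 : ℂ) 1, z' ≠ z₀ → f z = f z' → z = z'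
  notK : ∀ z ∈ ball (0 : ℂ) 1, z ≠ z₀ → f z ∉ K
  pole : Tendsto f (𝓝[≠] z₀) (Bornology.cobounded ℂ)
  proper : ∀ N : Set ℂ, IsOpen N → K ⊆ N → ∃ ρ < 1, ∀ z ∈ ball (0 : ℂ) 1, ρ < ‖z‖ → z ≠ z₀ ∧ f z ∈ N

lemma CoreMap.hasLog {K : Set ℂ} {f : ℂ → ℂ} {z₀ : ℂ} (hc : CoreMap K f z₀) {z : ℂ}
    (hz : z ∈ ball (0 : ℂ) 1) (hz' : z ≠ z₀) : HasLogNear K (f z) := by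
  rcases K.eq_empty_or_nonempty with hK | hKne
  · exact HasLogNear.of_far (by simp [hK])
  let Q : ℂ → Prop := fun z => z = z₀ ∨ HasLogNear K (f z)
  have key : ∀ x ∈ ball (0 : ℂ) 1, ∀ᶠ y in 𝓝[ball (0 : ℂ) 1] x, (Q x ↔ Q y) := by
    intro x hx
    by_cases hx0 : x = z₀
    · obtain ⟨R, hR⟩ := hc.compact.isBounded.exists_norm_le
      have h1 : ∀ᶠ y in 𝓝[≠] z₀, R < ‖f y‖ :=
        (tendsto_norm_cobounded_atTop.comp hc.pole).eventually_gt_atTop R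
      rw [eventually_nhdsWithin_iff] at h1
      rw [hx0]
      refine (h1.filter_mono nhdsWithin_le_nhds).mono fun y hy => ?_
      refine ⟨fun _ => ?_, fun _ => Or.inl rfl⟩
      by_cases hy0 : y = z₀
      · exact Or.inl hy0
      · exact Or.inr (HasLogNear.of_far fun w hw => (hR w hw).trans_lt (hy hy0))
    · have hcont := (hc.an x hx hx0).continuousAt
      have hpos : 0 < infDist (f x) K :=
        (hc.compact.isClosed.notMem_iff_infDist_pos hKne).1 (hc.notK x hx hx0)
      have h1 : ∀ᶠ y in 𝓝 x, dist (f y) (f x) < infDist (f x) K / 2 :=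
        hcont (ball_mem_nhds _ (half_pos hpos))
      have h2 : ∀ᶠ y in 𝓝 x, y ≠ z₀ := eventually_ne_nhds hx0
      refine ((h1.and h2).filter_mono nhdsWithin_le_nhds).mono fun y hy => ?_
      obtain ⟨h3, h4⟩ := hy
      simp only [Q, hx0, h4, false_or]
      have hw : ∀ w ∈ K, infDist (f x) K ≤ dist (f x) w := fun w hw => infDist_le_dist_of_mem hw
      constructor
      · intro h
        refine h.of_close fun w hwK => ?_
        have := hw w hwK
        rw [← dist_eq_norm, ← dist_eq_norm, dist_comm w]
        linarith
      · intro h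
        refine h.of_close fun w hwK => ?_
        have h5 := hw w hwK
        have h6 := dist_triangle (f x) (f y) w
        rw [← dist_eq_norm, ← dist_eq_norm, dist_comm w, dist_comm (f x)]
        rw [dist_comm (f x) (f y)] at h6
        linarith
  have := (convex_ball (0 : ℂ) 1).isPreconnected.induction₂ (fun x y => (Q x ↔ Q y)) key
    (fun x y z _ _ _ h1 h2 => h1.trans h2) (fun x y _ _ h => h.symm) hc.hz₀ hz
  exact (this.1 (Or.inl rfl)).resolve_left hz'

noncomputable def cc (ζ : ℂ) (r : ℝ) (y : ℝ) : ℂ := ζ * (1 - r * Complex.exp (y * Complex.I))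

lemma cc_cont (ζ : ℂ) (r : ℝ) : Continuous (cc ζ r) := by
  unfold cc; fun_prop

lemma cc_norm {ζ : ℂ} (hζ : ‖ζ‖ = 1) (r : ℝ) (y : ℝ) :
    ‖cc ζ r y‖ ^ 2 = 1 - 2 * r * Real.cos y + r ^ 2 := by
  rw [cc, norm_mul, hζ, one_mul, ← Complex.normSq_eq_norm_sq, Complex.exp_mul_I, Complex.normSq_apply]
  simp [← Complex.ofReal_cos, ← Complex.ofReal_sin]
  nlinarith [Real.sin_sq_add_cos_sq y]

lemma cc_dist {ζ : ℂ} (hζ : ‖ζ‖ = 1) {r : ℝ} (hr : 0 < r) (y : ℝ) : ‖cc ζ r y - ζ‖ = r := by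
  have : cc ζ r y - ζ = -(ζ * (r * Complex.exp (y * Complex.I))) := by unfold cc; ring
  rw [this, norm_neg, norm_mul, norm_mul, hζ, Complex.norm_exp_ofReal_mul_I]
  simp [abs_of_pos hr]

lemma cc_surj {ζ : ℂ} (hζ : ‖ζ‖ = 1) {r : ℝ} (hr : 0 < r) {z : ℂ} (hz : ‖z - ζ‖ = r) :
    ∃ y : ℝ, -Real.pi < y ∧ y ≤ Real.pi ∧ z = cc ζ r y := by
  have hζ0 : ζ ≠ 0 := by rw [← norm_pos_iff, hζ]; exact one_pos
  refine ⟨Complex.arg ((ζ - z) / ζ), Complex.neg_pi_lt_arg _, Complex.arg_le_pi _, ?_⟩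
  have h := Complex.norm_mul_exp_arg_mul_I ((ζ - z) / ζ)
  rw [norm_div, hζ, div_one, norm_sub_rev, hz] at h
  rw [cc, h]
  field_simp
  ring

lemma ends_ordConnected {ζ : ℂ} (hζ : ‖ζ‖ = 1) {r : ℝ} (hr : 0 < r) {ρ : ℝ} {σ : ℝ} (hσ : σ = 1 ∨ σ = -1) :
    IsPreconnected {y : ℝ | (0 < y ∧ y < Real.pi) ∧ ρ < ‖cc ζ r (σ * y)‖ ∧ ‖cc ζ r (σ * y)‖ < 1} := by
  apply OrdConnected.isPreconnected
  have hcos : ∀ y, Real.cos (σ * y) = Real.cos y := by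
    intro y; rcases hσ with rfl | rfl <;> simp
  have hmono : ∀ y₁ y₂, 0 < y₁ → y₁ ≤ y₂ → y₂ < Real.pi → ‖cc ζ r (σ * y₁)‖ ≤ ‖cc ζ r (σ * y₂)‖ := by
    intro y₁ y₂ h1 h2 h3
    have h4 := Real.cos_le_cos_of_nonneg_of_le_pi h1.le h3.le h2
    apply le_of_sq_le_sq _ (norm_nonneg _)
    rw [cc_norm hζ, cc_norm hζ, hcos, hcos]
    nlinarith
  constructor
  rintro y₁ ⟨⟨h1, h2⟩, h3, h4⟩ y₂ ⟨⟨h5, h6⟩, h7, h8⟩ y ⟨h9, h10⟩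
  refine ⟨⟨h1.trans_le h9, h10.trans_lt h6⟩, h3.trans_le (hmono _ _ h1 h9 (h10.trans_lt h6)), 
    (hmono _ _ (h1.trans_le h9) h10 h6).trans_lt h8⟩

lemma exists_quot {Ω : Set ℂ} {h : ℂ → ℂ} {z₁ : ℂ} (hz₁ : z₁ ∈ Ω) (hΩ : IsOpen Ω)
    (han : ∀ z ∈ Ω, AnalyticAt ℂ h z) (h0 : h z₁ = 0) (hne : ∀ z ∈ Ω, z ≠ z₁ → h z ≠ 0) :
    ∃ (n : ℕ) (Q : ℂ → ℂ), n ≠ 0 ∧ ContinuousOn Q Ω ∧ (∀ z ∈ Ω, Q z ≠ 0) ∧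
      ∀ z ∈ Ω, z ≠ z₁ → h z = (z - z₁) ^ n * Q z := by
  have h1 : ¬ ∀ᶠ z in 𝓝 z₁, h z = 0 := by
    intro h2
    have h3 : ∀ᶠ z in 𝓝[≠] z₁, h z = 0 ∧ z ∈ Ω ∧ z ≠ z₁ := by
      refine (h2.filter_mono nhdsWithin_le_nhds).and (((hΩ.eventually_mem hz₁).filter_mono nhdsWithin_le_nhds).and eventually_mem_nhdsWithin)
    obtain ⟨z, h4, h5, h6⟩ := h3.exists
    exact hne z h5 h6 h4
  obtain ⟨n, k, hk, hk0, hev⟩ := (han z₁ hz₁).exists_eventuallyEq_pow_smul_nonzero_iff.2 h1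
  have hn : n ≠ 0 := by
    rintro rfl
    have := hev.self_of_nhds
    simp [h0] at this
    exact hk0 this.symm
  refine ⟨n, Function.update (fun z => h z / (z - z₁) ^ n) z₁ (k z₁), hn, ?_, ?_, ?_⟩
  · intro z hz
    apply ContinuousAt.continuousWithinAt
    by_cases hzz : z = z₁
    · subst hzz
      apply hk.continuousAt.congr
      filter_upwards [hev] with w hw
      by_cases hww : w = z
      · subst hww; simp
      · rw [Function.update_of_ne hww, hw]
        have : w - z ≠ 0 := sub_ne_zero.2 hww
        simp only [smul_eq_mul]
        field_simp
    · rw [continuousAt_update_of_ne hzz]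
      exact (han z hz).continuousAt.div (by fun_prop) (pow_ne_zero _ (sub_ne_zero.2 hzz))
  · intro z hz
    by_cases hzz : z = z₁
    · subst hzz; simpa using hk0
    · rw [Function.update_of_ne hzz]
      exact div_ne_zero (hne z hz hzz) (pow_ne_zero _ (sub_ne_zero.2 hzz))
  · intro z hz hzz
    rw [Function.update_of_ne hzz]
    have : z - z₁ ≠ 0 := sub_ne_zero.2 hzz
    field_simp


lemma exists_log_ball {a w₁ : ℂ} {ε : ℝ} (h : w₁ ∉ ball a ε) :
    ∃ g : ℂ → ℂ, ContinuousOn g (ball a ε) ∧ ∀ w ∈ ball a ε, Complex.exp (g w) = w - w₁ := by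
  rcases le_or_gt ε 0 with he | he
  · rw [ball_eq_empty.2 he]
    exact ⟨0, by simp, by simp⟩
  have hne : (ball a ε).Nonempty := ⟨a, mem_ball_self he⟩
  obtain ⟨g, hg, hge⟩ := Complex.exists_continuousOn_eqOn_exp_comp (convex_sc (convex_ball a ε) hne)
    isOpen_ball (g := fun w => w - w₁) (by fun_prop) (by
      rintro ⟨w, hw, hw0⟩
      rw [sub_eq_zero.1 hw0] at hw
      exact h hw)
  exact ⟨g, hg, hge⟩

lemma CoreMap.sep {K : Set ℂ} {f : ℂ → ℂ} {z₀ : ℂ} (hc : CoreMap K f z₀) {ζ : ℂ} (hζ : ‖ζ‖ = 1)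
    {r : ℝ} (hr : 0 < r) (hr1 : r < 1) (hz₀ : r < ‖z₀ - ζ‖) {a : ℂ} {ε : ℝ}
    (hγ : ∀ z ∈ ball (0 : ℂ) 1, ‖z - ζ‖ = r → f z ∈ ball a ε)
    {L : Set ℂ} (hL : IsPreconnected L) (hLK : L ⊆ K) (hLB : L ⊆ ball a ε)
    (hends : ∀ σ : ℝ, (σ = 1 ∨ σ = -1) → ∃ y : ℕ → ℝ, ∃ p ∈ L, 
      (∀ j, (0 < y j ∧ y j < Real.pi) ∧ ‖cc ζ r (σ * y j)‖ < 1) ∧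
      Tendsto (fun j => ‖cc ζ r (σ * y j)‖) atTop (𝓝 1) ∧
      Tendsto (fun j => f (cc ζ r (σ * y j))) atTop (𝓝 p)) :
    ∀ z ∈ ball (0 : ℂ) 1, ‖z - ζ‖ < r → f z ∈ ball a ε := by
  intro z₁ hz₁ hz₁r
  by_contra hw₁
  have hnz : ∀ z, ‖z - ζ‖ ≤ r → z ≠ z₀ := by
    rintro z hz rfl
    linarith
  have hz10 := hnz z₁ hz₁r.le
  obtain ⟨g₁, hg₁, hg₁e⟩ := exists_log_ball hw₁
  obtain ⟨N, hN, hKN, g₂', hg₂', hg₂e'⟩ := hc.hasLog hz₁ hz10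
  obtain ⟨c, hce, hcL⟩ := exp_eq_const hL (hg₁.mono hLB) (hg₂'.mono (hLK.trans hKN)) (fun x hx => by
    rw [hg₁e x (hLB hx), hg₂e' x (hKN (hLK hx))])
  set g₂ : ℂ → ℂ := fun w => g₂' w + c with hg₂d
  have hg₂ : ContinuousOn g₂ N := hg₂'.add continuousOn_const
  have hg₂e : ∀ w ∈ N, Complex.exp (g₂ w) = w - f z₁ := fun w hw => by
    rw [hg₂d, Complex.exp_add, hce, mul_one, hg₂e' w hw]
  have hfc : ∀ z ∈ ball (0 : ℂ) 1, z ≠ z₀ → ContinuousAt f z := fun z hz hz' => (hc.an z hz hz').continuousAt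
  obtain ⟨ρ₀, hρ₀, hρ₀N⟩ := hc.proper N hN hKN
  obtain ⟨ρ, hρ1, hρ2⟩ : ∃ ρ, max ρ₀ (max ‖z₁‖ (1 - r)) < ρ ∧ ρ < 1 := by
    apply exists_between
    simp only [mem_ball_zero_iff] at hz₁
    simp [hρ₀, hz₁, hr]
  simp only [max_lt_iff] at hρ1
  obtain ⟨hρa, hρb, hρc⟩ := hρ1
  have hρpos : 0 < ρ := (norm_nonneg _).trans_lt hρb
  have hNρ : ∀ z ∈ ball (0 : ℂ) 1, ρ₀ < ‖z‖ → f z ∈ N := fun z hz h => (hρ₀N z hz h).2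
  -- the two logarithms agree near the ends
  have hagree : ∀ z ∈ ball (0 : ℂ) 1, ‖z - ζ‖ = r → ρ ≤ ‖z‖ → g₁ (f z) = g₂ (f z) := by
    intro z hz hzr hzρ
    rw [mem_ball_zero_iff] at hz
    obtain ⟨y, hy1, hy2, hy⟩ := cc_surj hζ hr hzr
    have hy0 : y ≠ 0 := by
      rintro rfl
      have h1 := cc_norm hζ r 0
      rw [← hy] at h1
      have h2 : ‖z‖ ^ 2 = (1 - r) ^ 2 := by rw [h1, Real.cos_zero]; ring
      rw [sq_eq_sq₀ (norm_nonneg _) (by linarith)] at h2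
      linarith
    have hypi : y ≠ Real.pi := by
      rintro rfl
      have h1 := cc_norm hζ r Real.pi
      rw [← hy, Real.cos_pi] at h1
      nlinarith [norm_nonneg z]
    obtain ⟨σ, hσ, y', hy'0, hy'1, rfl⟩ : ∃ σ : ℝ, (σ = 1 ∨ σ = -1) ∧ ∃ y', 0 < y' ∧ y' < Real.pi ∧ y = σ * y' := by
      rcases lt_or_gt_of_ne hy0 with h | h
      · exact ⟨-1, Or.inr rfl, -y, by linarith, by linarith, by ring⟩
      · exact ⟨1, Or.inl rfl, y, h, lt_of_le_of_ne hy2 hypi, by ring⟩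
    obtain ⟨ys, p, hp, hys, hys1, hysp⟩ := hends σ hσ
    set I := {y : ℝ | (0 < y ∧ y < Real.pi) ∧ ρ₀ < ‖cc ζ r (σ * y)‖ ∧ ‖cc ζ r (σ * y)‖ < 1} with hI
    have hIc : IsPreconnected I := ends_ordConnected hζ hr hσ
    have hIball : ∀ y ∈ I, cc ζ r (σ * y) ∈ ball (0 : ℂ) 1 := fun y hy => by
      rw [mem_ball_zero_iff]; exact hy.2.2
    have hfI : ContinuousOn (fun y => f (cc ζ r (σ * y))) I := by
      intro y hy
      apply ContinuousAt.continuousWithinAt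
      apply ContinuousAt.comp (g := f) (f := fun y => cc ζ r (σ * y))
      · exact hfc _ (hIball y hy) (hnz _ (cc_dist hζ hr _).le)
      · exact ((cc_cont ζ r).comp (continuous_const.mul continuous_id)).continuousAt
    have hm1 : MapsTo (fun y => f (cc ζ r (σ * y))) I (ball a ε) := fun y hy => hγ _ (hIball y hy) (cc_dist hζ hr _)
    have hm2 : MapsTo (fun y => f (cc ζ r (σ * y))) I N := fun y hy => hNρ _ (hIball y hy) hy.2.1
    obtain ⟨d, -, hd⟩ := exp_eq_const hIc (hg₁.comp hfI hm1) (hg₂.comp hfI hm2) (fun y hy => by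
      simp only [Function.comp]
      rw [hg₁e _ (hm1 hy), hg₂e _ (hm2 hy)])
    have hev : ∀ᶠ j in atTop, ys j ∈ I := by
      filter_upwards [hys1.eventually (lt_mem_nhds hρ₀)] with j hj
      exact ⟨(hys j).1, hj, (hys j).2⟩
    have l1 : Tendsto (fun j => g₁ (f (cc ζ r (σ * ys j)))) atTop (𝓝 (g₁ p)) :=
      ((hg₁.continuousAt (isOpen_ball.mem_nhds (hLB hp))).tendsto.comp hysp)
    have l2 : Tendsto (fun j => g₂ (f (cc ζ r (σ * ys j)))) atTop (𝓝 (g₂ p)) :=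
      ((hg₂.continuousAt (hN.mem_nhds (hKN (hLK hp)))).tendsto.comp hysp)
    have l3 : Tendsto (fun j => g₁ (f (cc ζ r (σ * ys j)))) atTop (𝓝 (g₂ p + d)) := by
      refine (l2.add_const d).congr' ?_
      filter_upwards [hev] with j hj
      exact (hd _ hj).symm
    have hd0 : g₁ p = g₂ p + d := tendsto_nhds_unique l1 l3
    have hd1 : g₁ p = g₂ p := hcL p hp
    have hd2 : d = 0 := by
      rw [hd1] at hd0
      simpa using hd0.symm
    have := hd y' ⟨⟨hy'0, hy'1⟩, by rw [← hy]; linarith, by rw [← hy]; exact hz⟩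
    simp only [Function.comp, ← hy, hd2, add_zero] at this
    exact this
  -- the quotient
  set Ω : Set ℂ := ball 0 1 ∩ ball ζ ‖z₀ - ζ‖ with hΩ
  have hΩo : IsOpen Ω := isOpen_ball.inter isOpen_ball
  have hΩz : ∀ z ∈ Ω, z ≠ z₀ := by
    rintro z hz rfl
    have := hz.2
    rw [mem_ball, dist_eq_norm] at this
    exact lt_irrefl _ this
  have hz₁Ω : z₁ ∈ Ω := ⟨hz₁, by rw [mem_ball, dist_eq_norm]; linarith⟩
  obtain ⟨n, Q, hn, hQc, hQ0, hQ⟩ := exists_quot (h := fun z => f z - f z₁) hz₁Ω hΩo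
    (fun z hz => (hc.an z hz.1 (hΩz z hz)).sub analyticAt_const) (sub_self _)
    (fun z hz hne h0 => hne (hc.inj z hz.1 (hΩz z hz) z₁ hz₁ hz10 (sub_eq_zero.1 h0)))
  obtain ⟨q, hq, hqe⟩ := Complex.exists_continuousOn_eqOn_exp_comp
    (convex_sc ((convex_ball (0 : ℂ) 1).inter (convex_ball ζ ‖z₀ - ζ‖)) ⟨z₁, hz₁Ω⟩) hΩo hQc
    (by rintro ⟨z, hz, h0⟩; exact hQ0 z hz h0)
  set C : Set ℂ := closedBall 0 ρ ∩ closedBall ζ r with hC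
  have hCΩ : C ⊆ Ω := by
    intro z hz
    refine ⟨closedBall_subset_ball hρ2 hz.1, closedBall_subset_ball hz₀ hz.2⟩
  have hCnhds : ball 0 ρ ∩ ball ζ r ⊆ interior C :=
    interior_maximal (inter_subset_inter ball_subset_closedBall ball_subset_closedBall)
      (isOpen_ball.inter isOpen_ball)
  have hz₁i : z₁ ∈ interior C := hCnhds ⟨by rwa [mem_ball_zero_iff], by rwa [mem_ball, dist_eq_norm]⟩
  set A : Set ℂ := closedBall 0 ρ ∩ sphere ζ r
  set B : Set ℂ := sphere 0 ρ ∩ closedBall ζ r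
  have hAC : A ⊆ C := inter_subset_inter_right _ sphere_subset_closedBall
  have hBC : B ⊆ C := inter_subset_inter_left _ sphere_subset_closedBall
  have hCclosed : IsClosed C := isClosed_closedBall.inter isClosed_closedBall
  have hfr : frontier C ⊆ A ∪ B := by
    intro z hz
    have hzC : z ∈ C := hCclosed.frontier_subset hz
    by_contra hcon
    apply hz.2
    apply hCnhds
    simp only [A, B, mem_union, mem_inter_iff, not_or, not_and] at hcon
    have h1 : ‖z‖ ≤ ρ := by simpa using hzC.1
    have h2 : ‖z - ζ‖ ≤ r := by simpa [dist_eq_norm] using hzC.2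
    constructor
    · rw [mem_ball_zero_iff]
      refine lt_of_le_of_ne h1 fun h => hcon.2 (by simpa using h) hzC.2
    · rw [mem_ball, dist_eq_norm]
      refine lt_of_le_of_ne h2 fun h => hcon.1 hzC.1 (by simpa [dist_eq_norm] using h)
  have hfC : ContinuousOn f C := fun z hz => (hfc z (hCΩ hz).1 (hΩz z (hCΩ hz))).continuousWithinAt
  classical
  set G : ℂ → ℂ := fun z => if ‖z - ζ‖ = r then g₁ (f z) else g₂ (f z) with hG
  have hGA : EqOn G (fun z => g₁ (f z)) A := by
    intro z hz
    have : ‖z - ζ‖ = r := by simpa [dist_eq_norm] using hz.2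
    simp [hG, this]
  have hGB : EqOn G (fun z => g₂ (f z)) B := by
    intro z hz
    by_cases h : ‖z - ζ‖ = r
    · simp only [hG, h, if_true]
      have : ‖z‖ = ρ := by simpa using hz.1
      exact hagree z (hCΩ (hBC hz)).1 h this.ge
    · simp [hG, h]
  have hmA : MapsTo f A (ball a ε) := fun z hz =>
    hγ z (hCΩ (hAC hz)).1 (by simpa [dist_eq_norm] using hz.2)
  have hmB : MapsTo f B N := fun z hz => hNρ z (hCΩ (hBC hz)).1 (by
    have : ‖z‖ = ρ := by simpa using hz.1
    linarith)
  have hGc : ContinuousOn G (A ∪ B) := by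
    apply ContinuousOn.union_of_isClosed
    · exact (hg₁.comp (hfC.mono hAC) hmA).congr hGA
    · exact (hg₂.comp (hfC.mono hBC) hmB).congr hGB
    · exact isClosed_closedBall.inter isClosed_sphere
    · exact isClosed_sphere.inter isClosed_closedBall
  have hGe : ∀ z ∈ A ∪ B, Complex.exp (G z) = f z - f z₁ := by
    rintro z (hz | hz)
    · rw [hGA hz]; exact hg₁e _ (hmA hz)
    · rw [hGB hz]; exact hg₂e _ (hmB hz)
  refine no_log_frontier (C := C) ((convex_closedBall _ _).inter (convex_closedBall _ _))
    (isBounded_closedBall.subset inter_subset_left) (mem_interior_iff_mem_nhds.1 hz₁i)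
    (m := fun z => G z - q z) ((hGc.mono hfr).sub (hq.mono (hCclosed.frontier_subset.trans hCΩ))) n hn ?_
  intro z hz
  have hzΩ := hCΩ (hCclosed.frontier_subset hz)
  have hzne : z ≠ z₁ := by
    rintro rfl
    exact hz.2 hz₁i
  have h1 : Complex.exp (q z) = Q z := hqe hzΩ
  have h2 : f z - f z₁ = (z - z₁) ^ n * Q z := hQ z hzΩ hzne
  rw [Complex.exp_sub, hGe z (hfr hz), h1, h2]
  have := hQ0 z hzΩ
  field_simp

open MeasureTheory in
lemma slice_small {H : ℂ → ENNReal} (hH : Measurable H) (hfin : ∫⁻ s, H s < ⊤) (b : ℝ) {η : ENNReal}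
    (hη : 0 < η) : ∃ x < b, ∫⁻ y : ℝ, H (x + y * Complex.I) < η := by
  by_contra hcon
  push Not at hcon
  have h1 : ∫⁻ s, H s = ∫⁻ x : ℝ, ∫⁻ y : ℝ, H (x + y * Complex.I) := by
    have hm : Measurable fun p : ℝ × ℝ => H (p.1 + p.2 * Complex.I) := by
      apply hH.comp
      fun_prop
    rw [← lintegral_prod (fun p : ℝ × ℝ => H (p.1 + p.2 * Complex.I)) hm.aemeasurable]
    rw [← Complex.volume_preserving_equiv_real_prod.symm.lintegral_comp_emb
      Complex.measurableEquivRealProd.symm.measurableEmbedding]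
    congr 1
    ext p
    congr 1
    apply Complex.ext <;> simp [Complex.measurableEquivRealProd]
  have h2 : ∫⁻ x in Iio b, η ≤ ∫⁻ x : ℝ, ∫⁻ y : ℝ, H (x + y * Complex.I) := by
    refine le_trans ?_ (setLIntegral_le_lintegral (Iio b) _)
    exact setLIntegral_mono' measurableSet_Iio fun x hx => hcon x hx
  rw [← h1] at h2
  simp only [lintegral_const, Measure.restrict_apply_univ, Real.volume_Iio] at h2
  rw [ENNReal.mul_top hη.ne'] at h2
  exact absurd (h2.trans_lt hfin) (lt_irrefl _)

lemma det_mul_complex (c : ℂ) : 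
    ((ContinuousLinearMap.toSpanSingleton ℂ c).restrictScalars ℝ : ℂ →L[ℝ] ℂ).det = ‖c‖ ^ 2 := by
  rw [← Complex.normSq_eq_norm_sq, ← Algebra.norm_complex_apply]
  rw [Algebra.norm_apply]
  rw [ContinuousLinearMap.det]
  congr 1
  ext <;> simp [mul_comm]

open MeasureTheory in
lemma area_finite {S : Set ℂ} (hS : IsOpen S) {F : ℂ → ℂ} (hF : DifferentiableOn ℂ F S) (hinj : InjOn F S)
    (hb : Bornology.IsBounded (F '' S)) :
    ∫⁻ s, S.indicator (fun s => ENNReal.ofReal (‖deriv F s‖ ^ 2)) s < ⊤ := by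
  rw [lintegral_indicator hS.measurableSet]
  have := lintegral_abs_det_fderiv_eq_addHaar_image (volume : Measure ℂ) hS.measurableSet 
    (f := F) (f' := fun s => (ContinuousLinearMap.toSpanSingleton ℂ (deriv F s)).restrictScalars ℝ)
    (fun s hs => by
      have h1 : HasDerivAt F (deriv F s) s := (hF.differentiableAt (hS.mem_nhds hs)).hasDerivAt
      exact (h1.hasFDerivAt.restrictScalars ℝ).hasFDerivWithinAt) hinj
  simp only [det_mul_complex, abs_pow, abs_norm] at this
  rw [this]
  exact hb.measure_lt_top

lemma exists_small_slice {S : Set ℂ} (hS : IsOpen S) {F : ℂ → ℂ} (hF : DifferentiableOn ℂ F S) (hinj : InjOn F S)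
    (hb : Bornology.IsBounded (F '' S)) (hSim : ∀ s ∈ S, |s.im| < Real.pi)
    (hSc : ∀ x y₁ y₂ y : ℝ, (x + y₁ * Complex.I : ℂ) ∈ S → (x + y₂ * Complex.I : ℂ) ∈ S → y₁ ≤ y → y ≤ y₂ →
      (x + y * Complex.I : ℂ) ∈ S) (b : ℝ) {δ : ℝ} (hδ : 0 < δ) : ∃ x < b, ∀ y₁ y₂ : ℝ, 
      (x + y₁ * Complex.I : ℂ) ∈ S → (x + y₂ * Complex.I : ℂ) ∈ S → y₁ ≤ y₂ → 
        ‖F (x + y₂ * Complex.I) - F (x + y₁ * Complex.I)‖ ≤ δ := by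
  have hπ := Real.pi_pos
  set c : ℝ := δ / (2 * Real.pi) with hc
  have hcpos : 0 < c := by positivity
  have hm : Measurable (S.indicator (fun s => ENNReal.ofReal (‖deriv F s‖ ^ 2))) := by
    apply Measurable.indicator _ hS.measurableSet
    exact (((measurable_deriv F).norm).pow_const 2).ennreal_ofReal
  obtain ⟨x, hxb, hx⟩ := slice_small hm (area_finite hS hF hinj hb) b (η := ENNReal.ofReal (c * δ)) 
    (by simp; positivity)
  refine ⟨x, hxb, fun y₁ y₂ h1 h2 h12 => ?_⟩
  have hseg : ∀ y ∈ Icc y₁ y₂, (x + y * Complex.I : ℂ) ∈ S := fun y hy => hSc x y₁ y₂ y h1 h2 hy.1 hy.2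
  have hline : Continuous (fun y : ℝ => (x + y * Complex.I : ℂ)) := by fun_prop
  have hdc : ContinuousOn (fun y : ℝ => deriv F (x + y * Complex.I)) (Icc y₁ y₂) :=
    ((hF.analyticOnNhd hS).deriv.continuousOn).comp hline.continuousOn hseg
  have hder : ∀ y ∈ uIcc y₁ y₂, HasDerivAt (fun y : ℝ => F (x + y * Complex.I)) (deriv F (x + y * Complex.I) * Complex.I) y := by
    intro y hy
    rw [uIcc_of_le h12] at hy
    have h3 : HasDerivAt F (deriv F (x + y * Complex.I)) (x + y * Complex.I) :=
      (hF.differentiableAt (hS.mem_nhds (hseg y hy))).hasDerivAt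
    have h4 : HasDerivAt (fun y : ℝ => (x + y * Complex.I : ℂ)) Complex.I y := by
      have := ((Complex.ofRealCLM.hasDerivAt (x := y)).mul_const Complex.I).const_add (x : ℂ)
      simpa using this
    exact h3.comp y h4
  have hint : IntervalIntegrable (fun y : ℝ => deriv F (x + y * Complex.I) * Complex.I) MeasureTheory.volume y₁ y₂ := by
    apply ContinuousOn.intervalIntegrable
    rw [uIcc_of_le h12]
    exact hdc.mul continuousOn_const
  rw [← intervalIntegral.integral_eq_sub_of_hasDerivAt hder hint]
  have hsqc : ContinuousOn (fun y : ℝ => ‖deriv F (x + y * Complex.I)‖ ^ 2) (Icc y₁ y₂) := hdc.norm.pow 2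
  have hsqi : IntervalIntegrable (fun y : ℝ => ‖deriv F (x + y * Complex.I)‖ ^ 2) MeasureTheory.volume y₁ y₂ := by
    apply ContinuousOn.intervalIntegrable
    rwa [uIcc_of_le h12]
  have hA : ∫ y in y₁..y₂, ‖deriv F (x + y * Complex.I)‖ ^ 2 ≤ c * δ := by
    rw [intervalIntegral.integral_of_le h12]
    rw [← ENNReal.ofReal_le_ofReal_iff (by positivity)]
    rw [MeasureTheory.ofReal_integral_eq_lintegral_ofReal hsqi.1 (Eventually.of_forall fun y => by positivity)]
    refine le_trans ?_ hx.le
    refine le_trans ?_ (MeasureTheory.setLIntegral_le_lintegral (Ioc y₁ y₂) _)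
    refine MeasureTheory.setLIntegral_mono' measurableSet_Ioc fun y hy => ?_
    rw [indicator_of_mem (hseg y (Ioc_subset_Icc_self hy))]
  calc ‖∫ y in y₁..y₂, deriv F (x + y * Complex.I) * Complex.I‖ 
      ≤ ∫ y in y₁..y₂, (‖deriv F (x + y * Complex.I)‖ ^ 2 / (2 * c) + c / 2) := by
        apply intervalIntegral.norm_integral_le_of_norm_le h12
        · refine Eventually.of_forall fun y _ => ?_
          rw [norm_mul, Complex.norm_I, mul_one]
          have : 0 ≤ (‖deriv F (x + y * Complex.I)‖ - c) ^ 2 / (2 * c) := by positivity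
          have h5 : (‖deriv F (x + y * Complex.I)‖ - c) ^ 2 / (2 * c) = 
            ‖deriv F (x + y * Complex.I)‖ ^ 2 / (2 * c) + c / 2 - ‖deriv F (x + y * Complex.I)‖ := by
            field_simp; ring
          linarith
        · exact (hsqi.div_const _).add intervalIntegrable_const
    _ = (∫ y in y₁..y₂, ‖deriv F (x + y * Complex.I)‖ ^ 2) / (2 * c) + (y₂ - y₁) * (c / 2) := by
        rw [intervalIntegral.integral_add (hsqi.div_const _) intervalIntegrable_const]
        simp
        ring
    _ ≤ c * δ / (2 * c) + (2 * Real.pi) * (c / 2) := by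
        have h3 := hSim _ h1
        have h4 := hSim _ h2
        simp only [Complex.add_im, Complex.ofReal_im, Complex.mul_im, Complex.ofReal_re, Complex.I_im, Complex.I_re, mul_zero, mul_one, add_zero, zero_add] at h3 h4
        rw [abs_lt] at h3 h4
        gcongr
        linarith
    _ = δ := by rw [hc]; field_simp; ring

lemma length_area {f : ℂ → ℂ} {ζ : ℂ} (hζ : ‖ζ‖ = 1) {r₀ : ℝ} (hr₀ : 0 < r₀) 
    (han : ∀ z ∈ ball (0 : ℂ) 1, ‖z - ζ‖ < r₀ → AnalyticAt ℂ f z)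
    (hinj : ∀ z ∈ ball (0 : ℂ) 1, ‖z - ζ‖ < r₀ → ∀ z' ∈ ball (0 : ℂ) 1, ‖z' - ζ‖ < r₀ → f z = f z' → z = z')
    {M : ℝ} (hM : ∀ z ∈ ball (0 : ℂ) 1, ‖z - ζ‖ < r₀ → ‖f z‖ ≤ M) {δ : ℝ} (hδ : 0 < δ) :
    ∃ r, 0 < r ∧ r < r₀ ∧ ∀ z ∈ ball (0 : ℂ) 1, ‖z - ζ‖ = r → ∀ z' ∈ ball (0 : ℂ) 1, ‖z' - ζ‖ = r → 
      dist (f z) (f z') ≤ δ := by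
  have hζ0 : ζ ≠ 0 := by rw [← norm_pos_iff, hζ]; exact one_pos
  set e : ℂ → ℂ := fun s => ζ * (1 - Complex.exp s) with he
  have hed : Differentiable ℂ e := by fun_prop
  set S : Set ℂ := {s | s.re < Real.log r₀} ∩ {s | |s.im| < Real.pi} ∩ {s | ‖e s‖ < 1} with hS
  have hSo : IsOpen S := ((isOpen_lt Complex.continuous_re continuous_const).inter 
    (isOpen_lt Complex.continuous_im.abs continuous_const)).inter (isOpen_lt hed.continuous.norm continuous_const)
  have he1 : ∀ s, ‖e s - ζ‖ = Real.exp s.re := by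
    intro s
    have : e s - ζ = -(ζ * Complex.exp s) := by simp only [he]; ring
    rw [this, norm_neg, norm_mul, hζ, one_mul, Complex.norm_exp]
  have heS : ∀ s ∈ S, e s ∈ ball (0 : ℂ) 1 ∧ ‖e s - ζ‖ < r₀ := by
    rintro s ⟨⟨h1, h2⟩, h3⟩
    refine ⟨by rwa [mem_ball_zero_iff], ?_⟩
    rw [he1, ← Real.lt_log_iff_exp_lt hr₀]
    exact h1
  have hecc : ∀ x y : ℝ, e (x + y * Complex.I) = cc ζ (Real.exp x) y := by
    intro x y
    simp only [he, cc, Complex.exp_add, Complex.ofReal_exp]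
  have hmem : ∀ x y : ℝ, (x + y * Complex.I : ℂ) ∈ S ↔ x < Real.log r₀ ∧ |y| < Real.pi ∧ ‖cc ζ (Real.exp x) y‖ < 1 := by
    intro x y
    rw [← hecc]
    simp [hS, and_assoc]
  obtain ⟨x, hx, hxs⟩ := exists_small_slice hSo (F := fun s => f (e s)) 
    (fun s hs => ((han _ (heS s hs).1 (heS s hs).2).differentiableAt.comp s (hed s)).differentiableWithinAt)
    (by
      intro s hs t ht hst
      have h1 := hinj _ (heS s hs).1 (heS s hs).2 _ (heS t ht).1 (heS t ht).2 hst
      simp only [he, mul_right_inj' hζ0, sub_right_inj] at h1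
      have hs2 := abs_lt.1 (show |s.im| < Real.pi from hs.1.2)
      have ht2 := abs_lt.1 (show |t.im| < Real.pi from ht.1.2)
      exact Complex.exp_inj_of_neg_pi_lt_of_le_pi hs2.1 hs2.2.le ht2.1 ht2.2.le h1)
    (by
      rw [isBounded_iff_forall_norm_le]
      refine ⟨M, ?_⟩
      rintro _ ⟨s, hs, rfl⟩
      exact hM _ (heS s hs).1 (heS s hs).2)
    (fun s hs => hs.1.2)
    (by
      intro x y₁ y₂ y h1 h2 h3 h4
      rw [hmem] at h1 h2 ⊢
      obtain ⟨h5, h6, h7⟩ := h1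
      obtain ⟨-, h8, h9⟩ := h2
      have hex := Real.exp_pos x
      have hy : |y| ≤ max |y₁| |y₂| := abs_le_max_abs_abs h3 h4
      have key : ∀ t, |t| < Real.pi → |y| ≤ |t| → ‖cc ζ (Real.exp x) t‖ < 1 → |y| < Real.pi ∧ ‖cc ζ (Real.exp x) y‖ < 1 := by
        intro t ht1 ht2 ht3
        refine ⟨ht2.trans_lt ht1, lt_of_le_of_lt ?_ ht3⟩
        apply le_of_sq_le_sq _ (norm_nonneg _)
        rw [cc_norm hζ, cc_norm hζ, ← Real.cos_abs y, ← Real.cos_abs t]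
        have := Real.cos_le_cos_of_nonneg_of_le_pi (abs_nonneg y) ht1.le ht2
        nlinarith
      rcases le_max_iff.1 hy with h | h
      · exact ⟨h5, key _ h6 h h7⟩
      · exact ⟨h5, key _ h8 h h9⟩) (Real.log r₀) hδ
  have hex := Real.exp_pos x
  refine ⟨Real.exp x, hex, by rwa [← Real.lt_log_iff_exp_lt hr₀], ?_⟩
  have hz : ∀ z ∈ ball (0 : ℂ) 1, ‖z - ζ‖ = Real.exp x → ∃ y : ℝ, (x + y * Complex.I : ℂ) ∈ S ∧ z = e (x + y * Complex.I) := by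
    intro z hz hzr
    rw [mem_ball_zero_iff] at hz
    obtain ⟨y, hy1, hy2, hy⟩ := cc_surj hζ hex hzr
    refine ⟨y, ?_, by rw [hecc, hy]⟩
    rw [hmem]
    refine ⟨hx, ?_, by rwa [← hy]⟩
    rw [abs_lt]
    refine ⟨hy1, lt_of_le_of_ne hy2 ?_⟩
    rintro rfl
    have h1 := cc_norm hζ (Real.exp x) Real.pi
    rw [← hy, Real.cos_pi] at h1
    nlinarith [norm_nonneg z]
  intro z hz1 hz2 z' hz1' hz2'
  obtain ⟨y, hyS, rfl⟩ := hz z hz1 hz2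
  obtain ⟨y', hyS', rfl⟩ := hz z' hz1' hz2'
  rcases le_total y y' with h | h
  · rw [dist_comm, dist_eq_norm]
    exact hxs y y' hyS hyS' h
  · rw [dist_eq_norm]
    exact hxs y' y hyS' hyS h


lemma CoreMap.lim_mem {K : Set ℂ} {f : ℂ → ℂ} {z₀ : ℂ} (hc : CoreMap K f z₀) {w : ℕ → ℂ} {p : ℂ}
    (hw : ∀ j, ‖w j‖ < 1) (hw1 : Tendsto (fun j => ‖w j‖) atTop (𝓝 1))
    (hp : Tendsto (fun j => f (w j)) atTop (𝓝 p)) : p ∈ K := by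
  by_contra hpK
  obtain ⟨η, hη, hηK⟩ := Metric.mem_nhds_iff.1 (hc.compact.isClosed.isOpen_compl.mem_nhds hpK)
  obtain ⟨ρ, hρ, hN⟩ := hc.proper (closedBall p (η / 2))ᶜ isClosed_closedBall.isOpen_compl (by
    intro k hk hkb
    exact hηK (closedBall_subset_ball (by linarith) hkb) hk)
  have h1 := hw1.eventually (lt_mem_nhds hρ)
  have h2 := hp.eventually (closedBall_mem_nhds p (half_pos hη))
  obtain ⟨j, h3, h4⟩ := (h1.and h2).exists
  exact (hN _ (by rw [mem_ball_zero_iff]; exact hw j) h3).2 h4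

lemma CoreMap.bdd {K : Set ℂ} {f : ℂ → ℂ} {z₀ : ℂ} (hc : CoreMap K f z₀) {d : ℝ} (hd : 0 < d) :
    ∃ M, ∀ z ∈ ball (0 : ℂ) 1, d ≤ ‖z - z₀‖ → ‖f z‖ ≤ M := by
  obtain ⟨R, hR⟩ := hc.compact.isBounded.subset_ball 0
  obtain ⟨ρ, hρ, hN⟩ := hc.proper (ball 0 R) isOpen_ball hR
  have hcomp : IsCompact (closedBall (0 : ℂ) ρ ∩ {z | d ≤ ‖z - z₀‖}) :=
    (isCompact_closedBall _ _).inter_right (isClosed_le continuous_const (by fun_prop))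
  obtain ⟨M, hM⟩ := hcomp.exists_bound_of_continuousOn (f := f) (by
    rintro z ⟨hz1, hz2⟩
    refine (hc.an z (closedBall_subset_ball hρ hz1) ?_).continuousAt.continuousWithinAt
    rintro rfl
    have : d ≤ ‖z - z‖ := hz2
    simp at this
    linarith)
  refine ⟨max M R, fun z hz hzd => ?_⟩
  by_cases h : ‖z‖ ≤ ρ
  · exact (hM z ⟨by simpa using h, hzd⟩).trans (le_max_left _ _)
  · have := (hN z hz (not_le.1 h)).2
    rw [mem_ball_zero_iff] at this
    exact this.le.trans (le_max_right _ _)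

lemma CoreMap.main {K : Set ℂ} {f : ℂ → ℂ} {z₀ : ℂ} (hc : CoreMap K f z₀)
    (hlc : ∀ ε > 0, ∃ δ > 0, ∀ a ∈ K, ∀ b ∈ K, dist a b < δ → 
      ∃ L ⊆ K, L ⊆ ball a ε ∧ IsPreconnected L ∧ a ∈ L ∧ b ∈ L) {ζ : ℂ} (hζ : ‖ζ‖ = 1) {ε : ℝ} (hε : 0 < ε) :
    ∃ r > 0, ∃ a : ℂ, ∀ z ∈ ball (0 : ℂ) 1, ‖z - ζ‖ < r → z ≠ z₀ ∧ f z ∈ ball a ε := by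
  obtain ⟨δ, hδ, hL⟩ := hlc ε hε
  set δ' := min δ ε / 2 with hδ'
  have hδ'0 : 0 < δ' := by positivity
  have hδ'1 : δ' < δ := by have := min_le_left δ ε; linarith
  have hδ'2 : δ' < ε := by have := min_le_right δ ε; linarith
  have hz₀ := hc.hz₀
  rw [mem_ball_zero_iff] at hz₀
  have hd0 : 0 < ‖z₀ - ζ‖ := by
    rw [norm_pos_iff, sub_ne_zero]
    rintro rfl
    linarith
  set r₀ := min 1 (‖z₀ - ζ‖ / 2) with hr₀
  have hr₀0 : 0 < r₀ := by positivity
  have hr₀1 : r₀ ≤ 1 := min_le_left _ _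
  have hr₀2 : r₀ ≤ ‖z₀ - ζ‖ / 2 := min_le_right _ _
  have hfar : ∀ z, ‖z - ζ‖ < r₀ → ‖z₀ - ζ‖ / 2 ≤ ‖z - z₀‖ := by
    intro z hz
    have : ‖z₀ - ζ‖ ≤ ‖z - z₀‖ + ‖z - ζ‖ := by
      rw [norm_sub_rev z z₀]
      have := norm_add_le (z₀ - z) (z - ζ)
      simpa using this
    linarith
  have hne : ∀ z, ‖z - ζ‖ < r₀ → z ≠ z₀ := by
    rintro z hz rfl
    linarith
  obtain ⟨M, hM⟩ := hc.bdd (half_pos hd0)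
  obtain ⟨r, hr, hrr₀, hosc⟩ := length_area (f := f) hζ hr₀0 (fun z hz h => hc.an z hz (hne z h))
    (fun z hz h z' hz' h' => hc.inj z hz (hne z h) z' hz' (hne z' h'))
    (fun z hz h => hM z hz (hfar z h)) hδ'0
  have hr1 : r < 1 := by linarith
  have hends : ∀ σ : ℝ, (σ = 1 ∨ σ = -1) → ∃ y : ℕ → ℝ, ∃ p ∈ K, 
      (∀ j, (0 < y j ∧ y j < Real.pi) ∧ ‖cc ζ r (σ * y j)‖ < 1) ∧
      Tendsto (fun j => ‖cc ζ r (σ * y j)‖) atTop (𝓝 1) ∧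
      Tendsto (fun j => f (cc ζ r (σ * y j))) atTop (𝓝 p) := by
    intro σ hσ
    have hcos : ∀ y, Real.cos (σ * y) = Real.cos y := by
      intro y; rcases hσ with rfl | rfl <;> simp
    set θ := Real.arccos (r / 2) with hθ
    have hcθ : Real.cos θ = r / 2 := Real.cos_arccos (by linarith) (by linarith)
    have hθ0 : 0 < θ := by rw [hθ, Real.arccos_pos]; linarith
    have hθπ : θ ≤ Real.pi := Real.arccos_le_pi _
    obtain ⟨u, -, hu, hulim⟩ := exists_seq_strictMono_tendsto' hθ0
    have h1 : ∀ j, ‖cc ζ r (σ * u j)‖ < 1 := by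
      intro j
      have h2 : Real.cos θ < Real.cos (u j) := Real.cos_lt_cos_of_nonneg_of_le_pi (hu j).1.le hθπ (hu j).2
      apply lt_of_pow_lt_pow_left₀ 2 zero_le_one
      rw [cc_norm hζ, hcos]
      nlinarith
    have h2 : ‖cc ζ r (σ * θ)‖ = 1 := by
      rw [← sq_eq_sq₀ (norm_nonneg _) zero_le_one, cc_norm hζ, hcos, hcθ]
      ring
    have h3 : Tendsto (fun j => ‖cc ζ r (σ * u j)‖) atTop (𝓝 1) := by
      rw [← h2]
      have : Continuous fun y => ‖cc ζ r (σ * y)‖ := ((cc_cont ζ r).comp (continuous_const.mul continuous_id)).norm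
      exact (this.tendsto θ).comp hulim
    obtain ⟨p, -, k, hk, hp⟩ := tendsto_subseq_of_bounded (x := fun j => f (cc ζ r (σ * u j)))
      (isBounded_closedBall (x := (0 : ℂ)) (r := M)) (fun j => by
        rw [mem_closedBall_zero_iff]
        exact hM _ (by rw [mem_ball_zero_iff]; exact h1 j) (hfar _ (by rw [cc_dist hζ hr]; exact hrr₀)))
    have h4 := h3.comp hk.tendsto_atTop
    exact ⟨u ∘ k, p, hc.lim_mem (w := fun j => cc ζ r (σ * (u ∘ k) j)) (fun j => h1 _) h4 hp, 
      fun j => ⟨⟨(hu _).1, (hu _).2.trans_le hθπ⟩, h1 _⟩, h4, hp⟩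
  obtain ⟨y₁, p₁, hp₁, hy₁, hn₁, hl₁⟩ := hends 1 (Or.inl rfl)
  obtain ⟨y₂, p₂, hp₂, hy₂, hn₂, hl₂⟩ := hends (-1) (Or.inr rfl)
  have hball : ∀ z ∈ ball (0 : ℂ) 1, ‖z - ζ‖ = r → dist (f z) p₁ ≤ δ' := by
    intro z hz hzr
    refine le_of_tendsto (tendsto_const_nhds.dist hl₁) (Eventually.of_forall fun j => ?_)
    exact hosc z hz hzr _ (by rw [mem_ball_zero_iff]; exact (hy₁ j).2) (cc_dist hζ hr _)
  have hdist : dist p₁ p₂ ≤ δ' := by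
    rw [dist_comm]
    refine le_of_tendsto (hl₂.dist tendsto_const_nhds) (Eventually.of_forall fun j => ?_)
    exact hball _ (by rw [mem_ball_zero_iff]; exact (hy₂ j).2) (cc_dist hζ hr _)
  obtain ⟨L, hLK, hLB, hLc, hL1, hL2⟩ := hL p₁ hp₁ p₂ hp₂ (hdist.trans_lt hδ'1)
  refine ⟨r, hr, p₁, fun z hz hzr => ⟨hne z (hzr.trans hrr₀), ?_⟩⟩
  refine hc.sep hζ hr hr1 (by linarith) (fun z hz hzr => (hball z hz hzr).trans_lt hδ'2) hLc hLK hLB ?_ z hz hzr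
  rintro σ (rfl | rfl)
  · exact ⟨y₁, p₁, hL1, hy₁, hn₁, hl₁⟩
  · exact ⟨y₂, p₂, hL2, hy₂, hn₂, hl₂⟩

lemma unif_lc {K : Set ℂ} (hK : IsCompact K) 
    (h : ∀ z ∈ K, ∀ V ∈ 𝓝[K] z, ∃ N ∈ 𝓝[K] z, N ⊆ K ∩ V ∧ IsPreconnected N) : 
    ∀ ε > 0, ∃ δ > 0, ∀ a ∈ K, ∀ b ∈ K, dist a b < δ → 
      ∃ L ⊆ K, L ⊆ ball a ε ∧ IsPreconnected L ∧ a ∈ L ∧ b ∈ L := by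
  intro ε hε
  have h1 : ∀ z : K, ∃ O : Set ℂ, IsOpen O ∧ (z : ℂ) ∈ O ∧ ∃ N ⊆ K, N ⊆ ball (z : ℂ) (ε / 2) ∧ IsPreconnected N ∧ O ∩ K ⊆ N := by
    intro z
    obtain ⟨N, hN, hNK, hNc⟩ := h z z.2 (ball (z : ℂ) (ε / 2)) (mem_nhdsWithin_of_mem_nhds (ball_mem_nhds _ (half_pos hε)))
    obtain ⟨O, hO, hzO, hON⟩ := mem_nhdsWithin.1 hN
    exact ⟨O, hO, hzO, N, hNK.trans inter_subset_left, hNK.trans inter_subset_right, hNc, hON⟩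
  choose O hO hzO N hNK hNb hNc hON using h1
  obtain ⟨δ, hδ, hδO⟩ := lebesgue_number_lemma_of_metric hK hO (fun z hz => mem_iUnion.2 ⟨⟨z, hz⟩, hzO ⟨z, hz⟩⟩)
  refine ⟨δ, hδ, fun a ha b hb hab => ?_⟩
  obtain ⟨i, hi⟩ := hδO a ha
  have haN : a ∈ N i := hON i ⟨hi (mem_ball_self hδ), ha⟩
  refine ⟨N i, hNK i, fun w hw => ?_, hNc i, haN, hON i ⟨hi (by rwa [mem_ball, dist_comm]), hb⟩⟩
  have h2 := hNb i hw
  have h3 := hNb i haN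
  rw [mem_ball] at *
  have := dist_triangle_right w a i
  linarith

lemma impression_eq_of_tendsto {φ : ℂ → ℂ∞} {ζ : ℂ} (hζ : ‖ζ‖ = 1) {p : ℂ∞}
    (h : Tendsto φ (𝓝[ball (0 : ℂ) 1] ζ) (𝓝 p)) : impression φ ζ = {p} := by
  ext z
  constructor
  · rintro ⟨w, hw, hwl, hwz⟩
    have h1 : Tendsto w atTop (𝓝[ball (0 : ℂ) 1] ζ) :=
      tendsto_nhdsWithin_iff.2 ⟨hwl, Eventually.of_forall hw⟩
    exact tendsto_nhds_unique hwz (h.comp h1)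
  · rintro rfl
    have h1 : ζ ∈ closure (ball (0 : ℂ) 1) := by
      rw [closure_ball _ one_ne_zero]; simp [hζ]
    obtain ⟨w, hw, hwl⟩ := mem_closure_iff_seq_limit.1 h1
    refine ⟨w, hw, hwl, h.comp (tendsto_nhdsWithin_iff.2 ⟨hwl, Eventually.of_forall hw⟩)⟩

lemma firstCountable_sphere : FirstCountableTopology ℂ∞ := by
  have h : Module.finrank ℝ ℂ + 1 = Fintype.card (Fin 3) := by simp
  have e := onePointEquivSphereOfFinrankEq (ι := Fin 3) (V := ℂ) h
  exact e.isInducing.firstCountableTopology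

lemma tendsto_of_impression {φ : ℂ → ℂ∞} {ζ : ℂ} {p : ℂ∞}
    (h : impression φ ζ = {p}) : Tendsto φ (𝓝[ball (0 : ℂ) 1] ζ) (𝓝 p) := by
  have := firstCountable_sphere
  apply tendsto_of_subseq_tendsto
  intro ns hns
  obtain ⟨hns1, hns2⟩ := tendsto_nhdsWithin_iff.1 hns
  obtain ⟨k, hk⟩ := eventually_atTop.1 hns2
  obtain ⟨q, -, ms, hms, hq⟩ := (isSeqCompact_univ (X := ℂ∞)) (x := fun n => φ (ns (n + k))) (fun n => trivial)
  have hmem : q ∈ impression φ ζ := by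
    refine ⟨fun n => ns (ms n + k), fun j => hk _ (Nat.le_add_left _ _), ?_, hq⟩
    exact hns1.comp ((tendsto_add_atTop_nat k).comp hms.tendsto_atTop)
  rw [h] at hmem
  obtain rfl : q = p := hmem
  exact ⟨fun n => ms n + k, hq⟩

lemma lc_of_curve {U : Set ℂ∞} (hU : IsOpen U) (hinf : ∞ ∈ U) {c : ℝ → ℂ∞} (hc : Continuous c)
    (ha : ∀ t, c t ∈ Uᶜ) (hb : ∀ p ∈ Uᶜ, p ∈ closure U → ∃ t ∈ Icc (-Real.pi) Real.pi, c t = p) :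
    ∀ z ∈ Uᶜ, LocallyConnectedAt Uᶜ z := by
  intro z hz V hV
  obtain ⟨w, rfl⟩ : ∃ w : ℂ, (w : ℂ∞) = z := by
    apply OnePoint.ne_infty_iff_exists.1
    rintro rfl
    exact hz hinf
  obtain ⟨O, hO, hzO, hOV⟩ := mem_nhdsWithin.1 hV
  have hball : ∀ O' : Set ℂ∞, IsOpen O' → (w : ℂ∞) ∈ O' → ∃ δ > 0, ((↑) : ℂ → ℂ∞) '' ball w δ ⊆ O' := by
    intro O' hO' hw
    obtain ⟨δ, hδ, h⟩ := Metric.isOpen_iff.1 (hO'.preimage OnePoint.continuous_coe) w hw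
    exact ⟨δ, hδ, image_subset_iff.2 h⟩
  have hnh : ∀ δ > 0, ((↑) : ℂ → ℂ∞) '' ball w δ ∈ 𝓝 (w : ℂ∞) := fun δ hδ =>
    (OnePoint.isOpenMap_coe _ isOpen_ball).mem_nhds ⟨w, mem_ball_self hδ, rfl⟩
  by_cases hcl : (w : ℂ∞) ∈ closure U
  · set T : Set ℝ := {t | c t = w} with hT
    set J : ℝ → Set ℝ := fun t => connectedComponentIn (c ⁻¹' O) t with hJ
    have hOpre : IsOpen (c ⁻¹' O) := hO.preimage hc
    have hJo : ∀ t, IsOpen (J t) := fun t => hOpre.connectedComponentIn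
    have htJ : ∀ t ∈ T, t ∈ J t := fun t ht => mem_connectedComponentIn (by
      have : c t = w := ht
      rw [mem_preimage, this]; exact hzO)
    set N₀ : Set ℂ∞ := ⋃ t ∈ T, c '' J t with hN₀
    have hN₀O : N₀ ⊆ O := by
      refine iUnion₂_subset fun t ht => ?_
      rw [image_subset_iff]
      exact connectedComponentIn_subset _ _
    have hN₀U : N₀ ⊆ Uᶜ := by
      refine iUnion₂_subset fun t ht => ?_
      rintro _ ⟨s, -, rfl⟩
      exact ha s
    set T₁ : Set ℝ := Icc (-Real.pi) Real.pi \ ⋃ t ∈ T, J t with hT₁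
    have hT₁c : IsCompact T₁ := isCompact_Icc.diff (isOpen_biUnion fun t _ => hJo t)
    have hcT₁ : IsClosed (c '' T₁) := (hT₁c.image hc).isClosed
    obtain ⟨δ, hδ, hδO⟩ := hball (O ∩ (c '' T₁)ᶜ) (hO.inter hcT₁.isOpen_compl) ⟨hzO, by
      rintro ⟨t, ht, htw⟩
      exact ht.2 (mem_biUnion (show t ∈ T from htw) (htJ t htw))⟩
    set B : Set ℂ∞ := ((↑) : ℂ → ℂ∞) '' ball w δ with hB
    have hwB : (w : ℂ∞) ∈ B := ⟨w, mem_ball_self hδ, rfl⟩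
    refine ⟨N₀ ∪ (Uᶜ ∩ B), ?_, ?_, ⟨w, Or.inr ⟨hz, hwB⟩⟩, ?_⟩
    · exact mem_of_superset (inter_mem_nhdsWithin _ (hnh δ hδ)) subset_union_right
    · rintro p (hp | hp)
      · exact ⟨hN₀U hp, hOV ⟨hN₀O hp, hN₀U hp⟩⟩
      · exact ⟨hp.1, hOV ⟨(hδO hp.2).1, hp.1⟩⟩
    · have hJc : ∀ t, IsPreconnected (c '' J t) := fun t =>
        isPreconnected_connectedComponentIn.image _ hc.continuousOn
      have hJsub : ∀ t ∈ T, c '' J t ⊆ N₀ ∪ (Uᶜ ∩ B) := fun t ht =>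
        (subset_biUnion_of_mem (u := fun t => c '' J t) ht).trans subset_union_left
      apply isPreconnected_of_forall (w : ℂ∞)
      rintro p (hp | ⟨hpU, p', hp', rfl⟩)
      · obtain ⟨t, ht, hpt⟩ := mem_iUnion₂.1 hp
        exact ⟨c '' J t, hJsub t ht, ⟨t, htJ t ht, ht⟩, hpt, hJc t⟩
      · set l : ℝ → ℂ∞ := fun s => ((AffineMap.lineMap p' w s : ℂ) : ℂ∞) with hl
        have hlc : Continuous l := OnePoint.continuous_coe.comp AffineMap.lineMap_continuous
        have hl0 : l 0 = p' := by simp [hl]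
        have hl1 : l 1 = w := by simp [hl]
        have hlB : ∀ s ∈ Icc (0 : ℝ) 1, l s ∈ B := by
          intro s hs
          exact ⟨_, (convex_ball w δ).lineMap_mem hp' (mem_ball_self hδ) hs, rfl⟩
        have hcomp : IsCompact (Icc (0 : ℝ) 1 ∩ l ⁻¹' closure U) :=
          isCompact_Icc.inter_right (isClosed_closure.preimage hlc)
        obtain ⟨s, ⟨hs1, hs2⟩, hsmin⟩ := hcomp.exists_isLeast ⟨1, ⟨zero_le_one, le_rfl⟩, by
          rw [mem_preimage, hl1]; exact hcl⟩
        have hlt : ∀ t ∈ Ico 0 s, l t ∈ Uᶜ := by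
          intro t ht hU'
          have := hsmin ⟨⟨ht.1, ht.2.le.trans hs1.2⟩, subset_closure hU'⟩
          exact absurd ht.2 (not_lt.2 this)
        have hlU : ∀ t ∈ Icc 0 s, l t ∈ Uᶜ := by
          rcases eq_or_lt_of_le hs1.1 with h0 | h0
          · intro t ht
            have : t = 0 := le_antisymm (by rw [h0]; exact ht.2) ht.1
            rw [this, hl0]; exact hpU
          · intro t ht
            rw [← closure_Ico h0.ne] at ht
            have hcl' : IsClosed (l ⁻¹' Uᶜ) := hU.isClosed_compl.preimage hlc
            exact closure_minimal (fun t ht => hlt t ht) hcl' ht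
        obtain ⟨t₁, ht₁, ht₁s⟩ := hb (l s) (hlU s ⟨hs1.1, le_rfl⟩) hs2
        have hmem : t₁ ∈ ⋃ t ∈ T, J t := by
          by_contra hcon
          exact (hδO (hlB s hs1)).2 ⟨t₁, ⟨ht₁, hcon⟩, ht₁s⟩
        obtain ⟨t, ht, htt⟩ := mem_iUnion₂.1 hmem
        refine ⟨l '' Icc 0 s ∪ c '' J t, union_subset ?_ (hJsub t ht), Or.inr ⟨t, htJ t ht, ht⟩,
          Or.inl ⟨0, ⟨le_rfl, hs1.1⟩, hl0⟩, ?_⟩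
        · rintro _ ⟨x, hx, rfl⟩
          exact Or.inr ⟨hlU x hx, hlB x ⟨hx.1, hx.2.trans hs1.2⟩⟩
        · exact IsPreconnected.union (l s) ⟨s, ⟨hs1.1, le_rfl⟩, rfl⟩ ⟨t₁, htt, ht₁s⟩
            (isPreconnected_Icc.image _ hlc.continuousOn) (hJc t)
  · obtain ⟨δ, hδ, hδO⟩ := hball (O ∩ (closure U)ᶜ) (hO.inter isClosed_closure.isOpen_compl) ⟨hzO, hcl⟩
    have hBU : ((↑) : ℂ → ℂ∞) '' ball w δ ⊆ Uᶜ := fun p hp hpU => (hδO hp).2 (subset_closure hpU)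
    refine ⟨((↑) : ℂ → ℂ∞) '' ball w δ, mem_nhdsWithin_of_mem_nhds (hnh δ hδ), 
      fun p hp => ⟨hBU hp, hOV ⟨(hδO hp).1, hBU hp⟩⟩, ?_⟩
    exact ((convex_ball w δ).isConnected ⟨w, mem_ball_self hδ⟩).image _ OnePoint.continuous_coe.continuousOn


lemma coreMap_of_sphere
    (U : Set ℂ∞) (hUopen : IsOpen U) (hinfty : ∞ ∈ U)
    (φ : ℂ → ℂ∞) (ψ : ℂ∞ → ℂ)
    (hφcont : ContinuousOn φ (ball (0 : ℂ) 1))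
    (hφmaps : MapsTo φ (ball (0 : ℂ) 1) U)
    (hφhol : HolomorphicIntoSphereOn φ (ball (0 : ℂ) 1))
    (hψcont : ContinuousOn ψ U)
    (hψmaps : MapsTo ψ U (ball (0 : ℂ) 1))
    (hψφ : ∀ z ∈ ball (0 : ℂ) 1, ψ (φ z) = z)
    (hφψ : ∀ w ∈ U, φ (ψ w) = w)
    (f : ℂ → ℂ) (hf : ∀ z ∈ ball (0 : ℂ) 1, z ≠ ψ ∞ → ((f z : ℂ) : ℂ∞) = φ z) :
    CoreMap (((↑) : ℂ → ℂ∞) ⁻¹' Uᶜ) f (ψ ∞) := by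
  have himg : ((↑) : ℂ → ℂ∞) '' (((↑) : ℂ → ℂ∞) ⁻¹' Uᶜ) = Uᶜ := by
    apply image_preimage_eq_of_subset
    intro p hp
    obtain ⟨w, rfl⟩ := OnePoint.ne_infty_iff_exists.1 (show p ≠ ∞ by rintro rfl; exact hp hinfty)
    exact ⟨w, rfl⟩
  have hz₀ : ψ ∞ ∈ ball (0 : ℂ) 1 := hψmaps hinfty
  have hφz₀ : φ (ψ ∞) = ∞ := hφψ _ hinfty
  have hUD : ∀ z ∈ ball (0 : ℂ) 1, ball (0 : ℂ) 1 ∈ 𝓝 z := fun z hz => isOpen_ball.mem_nhds hz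
  refine ⟨?_, hz₀, ?_, ?_, ?_, ?_, ?_⟩
  · rw [OnePoint.isOpenEmbedding_coe.isEmbedding.isCompact_iff, himg]
    exact hUopen.isClosed_compl.isCompact
  · intro z hz hne
    have hev : ∀ᶠ w in 𝓝 z, ((f w : ℂ) : ℂ∞) = φ w := by
      filter_upwards [hUD z hz, isOpen_ne.mem_nhds hne] with w hw hw'
      exact hf w hw hw'
    rcases hφhol z hz with ⟨g, hg, h⟩ | ⟨g, hg, h⟩
    · refine hg.congr ?_
      filter_upwards [hev, h] with w h1 h2
      exact (OnePoint.coe_injective (h1.trans h2)).symm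
    · have hgz : g z ≠ 0 := by
        intro h0
        have h1 := h.self_of_nhds
        have h2 := hev.self_of_nhds
        rw [h1, if_pos h0] at h2
        exact OnePoint.coe_ne_infty _ h2
      refine (hg.inv hgz).congr ?_
      filter_upwards [hev, h, hg.continuousAt.eventually_ne hgz] with w h1 h2 h3
      rw [if_neg h3] at h2
      exact (OnePoint.coe_injective (h1.trans h2)).symm
  · intro z hz hne z' hz' hne' he
    rw [← hψφ z hz, ← hψφ z' hz', ← hf z hz hne, ← hf z' hz' hne', he]
  · intro z hz hne hK
    have : ((f z : ℂ) : ℂ∞) ∈ Uᶜ := hK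
    rw [hf z hz hne] at this
    exact this (hφmaps hz)
  · have h1 : Tendsto φ (𝓝[≠] (ψ ∞)) (𝓝 ∞) := by
      have := (hφcont.continuousAt (hUD _ hz₀)).tendsto
      rw [hφz₀] at this
      exact this.mono_left nhdsWithin_le_nhds
    have h2 : Tendsto (fun z => ((f z : ℂ) : ℂ∞)) (𝓝[≠] (ψ ∞)) (𝓝 ∞) := by
      refine h1.congr' ?_
      filter_upwards [mem_nhdsWithin_of_mem_nhds (hUD _ hz₀), self_mem_nhdsWithin] with w hw hw'
      exact (hf w hw hw').symm
    rw [Metric.cobounded_eq_cocompact, ← coclosedCompact_eq_cocompact, ← OnePoint.comap_coe_nhds_infty,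
      tendsto_comap_iff]
    exact h2
  · intro N hN hKN
    have hopen : IsOpen (((↑) : ℂ → ℂ∞) '' N) := OnePoint.isOpenMap_coe _ hN
    have hC : IsCompact (((↑) : ℂ → ℂ∞) '' N)ᶜ := hopen.isClosed_compl.isCompact
    have hCU : (((↑) : ℂ → ℂ∞) '' N)ᶜ ⊆ U := by
      rw [compl_subset_comm, ← himg]
      exact image_mono hKN
    have hinfC : ∞ ∈ (((↑) : ℂ → ℂ∞) '' N)ᶜ := by
      rintro ⟨x, -, hx⟩
      exact OnePoint.coe_ne_infty _ hx
    obtain ⟨p, hp, hmax⟩ := hC.exists_isMaxOn ⟨_, hinfC⟩ (hψcont.mono hCU).norm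
    refine ⟨‖ψ p‖, by simpa using hψmaps (hCU hp), ?_⟩
    intro z hz hlt
    have hmem : φ z ∈ ((↑) : ℂ → ℂ∞) '' N := by
      by_contra hcon
      have := hmax (show φ z ∈ (((↑) : ℂ → ℂ∞) '' N)ᶜ from hcon)
      simp only [mem_setOf_eq, hψφ z hz] at this
      linarith
    have hne : z ≠ ψ ∞ := by
      rintro rfl
      rw [hφz₀] at hmem
      exact hinfC hmem
    refine ⟨hne, ?_⟩
    rw [← hf z hz hne] at hmem
    obtain ⟨x, hx, hxe⟩ := hmem
    rwa [← OnePoint.coe_injective hxe]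

lemma stmt6_mp
    (U : Set ℂ∞) (hUopen : IsOpen U) (hinfty : ∞ ∈ U)
    (φ : ℂ → ℂ∞) (ψ : ℂ∞ → ℂ)
    (hφcont : ContinuousOn φ (ball (0 : ℂ) 1))
    (hφmaps : MapsTo φ (ball (0 : ℂ) 1) U)
    (hφhol : HolomorphicIntoSphereOn φ (ball (0 : ℂ) 1))
    (hψcont : ContinuousOn ψ U)
    (hψmaps : MapsTo ψ U (ball (0 : ℂ) 1))
    (hψφ : ∀ z ∈ ball (0 : ℂ) 1, ψ (φ z) = z)
    (hφψ : ∀ w ∈ U, φ (ψ w) = w)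
    (hlc : ∀ z ∈ Uᶜ, LocallyConnectedAt Uᶜ z) :
    ∀ ζ ∈ sphere (0 : ℂ) 1, ∃ z : ℂ∞, impression φ ζ = {z} := by
  have hex : ∀ z, ∃ w : ℂ, z ∈ ball (0 : ℂ) 1 → z ≠ ψ ∞ → ((w : ℂ) : ℂ∞) = φ z := by
    intro z
    by_cases h : φ z = ∞
    · refine ⟨0, fun hz hne => absurd ?_ hne⟩
      rw [← hψφ z hz, h]
    · obtain ⟨w, hw⟩ := OnePoint.ne_infty_iff_exists.1 h
      exact ⟨w, fun _ _ => hw⟩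
  choose f hf using hex
  have hc := coreMap_of_sphere U hUopen hinfty φ ψ hφcont hφmaps hφhol hψcont hψmaps hψφ hφψ f hf
  have hemb : IsEmbedding ((↑) : ℂ → ℂ∞) := OnePoint.isOpenEmbedding_coe.isEmbedding
  have himg : ((↑) : ℂ → ℂ∞) '' (((↑) : ℂ → ℂ∞) ⁻¹' Uᶜ) = Uᶜ := by
    apply image_preimage_eq_of_subset
    intro p hp
    obtain ⟨w, rfl⟩ := OnePoint.ne_infty_iff_exists.1 (show p ≠ ∞ by rintro rfl; exact hp hinfty)
    exact ⟨w, rfl⟩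
  have hlc' := unif_lc hc.compact (by
    intro z hz V hV
    have hmap := hemb.map_nhdsWithin_eq (((↑) : ℂ → ℂ∞) ⁻¹' Uᶜ) z
    rw [himg] at hmap
    have hV' : ((↑) : ℂ → ℂ∞) '' V ∈ 𝓝[Uᶜ] (z : ℂ∞) := by
      rw [← hmap]; exact image_mem_map hV
    obtain ⟨N, hN, hNs, hNc⟩ := hlc z hz _ hV'
    have hNe : ((↑) : ℂ → ℂ∞) '' (((↑) : ℂ → ℂ∞) ⁻¹' N) = N := by
      apply image_preimage_eq_of_subset
      intro p hp
      obtain ⟨w, -, hw⟩ := (hNs hp).2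
      exact ⟨w, hw⟩
    refine ⟨((↑) : ℂ → ℂ∞) ⁻¹' N, ?_, ?_, ?_⟩
    · rw [← hmap] at hN; exact hN
    · intro w hw
      refine ⟨(hNs hw).1, ?_⟩
      obtain ⟨x, hx, hxe⟩ := (hNs hw).2
      rwa [← OnePoint.coe_injective hxe]
    · rw [← hemb.isInducing.isPreconnected_image, hNe]
      exact hNc.isPreconnected)
  intro ζ hζ
  have hζ1 : ‖ζ‖ = 1 := by simpa using hζ
  have hNB : (𝓝[ball (0 : ℂ) 1] ζ).NeBot := by
    rw [← mem_closure_iff_nhdsWithin_neBot, closure_ball _ one_ne_zero]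
    simp [hζ1]
  have hmem : ∀ r > 0, ball (0 : ℂ) 1 ∩ ball ζ r ∈ 𝓝[ball (0 : ℂ) 1] ζ := fun r hr =>
    inter_mem self_mem_nhdsWithin (mem_nhdsWithin_of_mem_nhds (ball_mem_nhds _ hr))
  have hcau : Cauchy (map f (𝓝[ball (0 : ℂ) 1] ζ)) := by
    rw [Metric.cauchy_iff]
    refine ⟨inferInstance, fun ε hε => ?_⟩
    obtain ⟨r, hr, a, ha⟩ := hc.main hlc' hζ1 (half_pos hε)
    refine ⟨ball a (ε / 2), ?_, ?_⟩
    · rw [mem_map]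
      filter_upwards [hmem r hr] with z hz
      exact (ha z hz.1 (by simpa [dist_eq_norm] using hz.2)).2
    · intro x hx y hy
      have := dist_triangle_right x y a
      rw [mem_ball] at hx hy
      linarith
  obtain ⟨p, hp⟩ := cauchy_map_iff_exists_tendsto.1 hcau
  refine ⟨(p : ℂ∞), impression_eq_of_tendsto hζ1 ?_⟩
  have h2 : Tendsto (fun z => ((f z : ℂ) : ℂ∞)) (𝓝[ball (0 : ℂ) 1] ζ) (𝓝 (p : ℂ∞)) :=
    (OnePoint.continuous_coe.tendsto p).comp hp
  refine h2.congr' ?_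
  obtain ⟨r, hr, a, ha⟩ := hc.main hlc' hζ1 one_pos
  filter_upwards [hmem r hr] with z hz
  exact hf z hz.1 (ha z hz.1 (by simpa [dist_eq_norm] using hz.2)).1

lemma stmt6_mpr
    (U : Set ℂ∞) (hUopen : IsOpen U) (hinfty : ∞ ∈ U)
    (φ : ℂ → ℂ∞) (ψ : ℂ∞ → ℂ)
    (hφcont : ContinuousOn φ (ball (0 : ℂ) 1))
    (hφmaps : MapsTo φ (ball (0 : ℂ) 1) U)
    (hψcont : ContinuousOn ψ U)
    (hψmaps : MapsTo ψ U (ball (0 : ℂ) 1))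
    (hψφ : ∀ z ∈ ball (0 : ℂ) 1, ψ (φ z) = z)
    (hφψ : ∀ w ∈ U, φ (ψ w) = w)
    (himp : ∀ ζ ∈ sphere (0 : ℂ) 1, ∃ z : ℂ∞, impression φ ζ = {z}) :
    ∀ z ∈ Uᶜ, LocallyConnectedAt Uᶜ z := by
  have hlim : ∀ z ∈ closedBall (0 : ℂ) 1, ∃ p, Tendsto φ (𝓝[ball (0 : ℂ) 1] z) (𝓝 p) := by
    intro z hz
    rcases (mem_closedBall.1 hz).lt_or_eq with h | h
    · exact ⟨φ z, hφcont z h⟩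
    · obtain ⟨p, hp⟩ := himp z h
      exact ⟨p, tendsto_of_impression hp⟩
  set Φ := extendFrom (ball (0 : ℂ) 1) φ with hΦ
  have hcl : closure (ball (0 : ℂ) 1) = closedBall 0 1 := closure_ball _ one_ne_zero
  have hΦc : ContinuousOn Φ (closedBall (0 : ℂ) 1) := continuousOn_extendFrom hcl.ge hlim
  have hΦt : ∀ z ∈ closedBall (0 : ℂ) 1, Tendsto φ (𝓝[ball (0 : ℂ) 1] z) (𝓝 (Φ z)) := fun z hz =>
    tendsto_extendFrom (hlim z hz)
  have hΦin : ∀ z ∈ ball (0 : ℂ) 1, Φ z = φ z := fun z hz =>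
    extendFrom_eq (hcl ▸ ball_subset_closedBall hz) (hφcont z hz)
  have hE : ∀ t : ℝ, ‖Complex.exp (t * Complex.I)‖ = 1 := fun t => Complex.norm_exp_ofReal_mul_I t
  refine lc_of_curve hUopen hinfty (c := fun t : ℝ => Φ (Complex.exp (t * Complex.I))) ?_ ?_ ?_
  · refine hΦc.comp_continuous (by fun_prop) fun t => ?_
    simp [hE t]
  · intro t hU
    set ζ := Complex.exp (t * Complex.I) with hζ
    have hζ1 : ‖ζ‖ = 1 := hE t
    have hζc : ζ ∈ closedBall (0 : ℂ) 1 := by simp [hζ1]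
    have hNB : (𝓝[ball (0 : ℂ) 1] ζ).NeBot := by
      rw [← mem_closure_iff_nhdsWithin_neBot, hcl]; exact hζc
    have h1 : Tendsto (fun z => ψ (φ z)) (𝓝[ball (0 : ℂ) 1] ζ) (𝓝 (ψ (Φ ζ))) :=
      ((hψcont.continuousAt (hUopen.mem_nhds hU)).tendsto).comp (hΦt ζ hζc)
    have h2 : Tendsto (fun z => ψ (φ z)) (𝓝[ball (0 : ℂ) 1] ζ) (𝓝 ζ) := by
      refine (tendsto_id.mono_left nhdsWithin_le_nhds).congr' ?_
      filter_upwards [self_mem_nhdsWithin] with z hz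
      exact (hψφ z hz).symm
    have h3 := tendsto_nhds_unique h1 h2
    have h4 := hψmaps hU
    rw [h3] at h4
    simp [hζ1] at h4
  · intro p hp hpc
    have hcomp : IsClosed (Φ '' closedBall (0 : ℂ) 1) :=
      ((isCompact_closedBall _ _).image_of_continuousOn hΦc).isClosed
    have hsub : U ⊆ Φ '' closedBall (0 : ℂ) 1 := fun w hw =>
      ⟨ψ w, ball_subset_closedBall (hψmaps hw), by rw [hΦin _ (hψmaps hw), hφψ w hw]⟩
    obtain ⟨z, hz, rfl⟩ := closure_minimal hsub hcomp hpc
    have hz1 : ‖z‖ = 1 := by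
      refine le_antisymm (by simpa using hz) ?_
      by_contra hlt
      have hzb : z ∈ ball (0 : ℂ) 1 := by simpa using hlt
      rw [hΦin z hzb] at hp
      exact hp (hφmaps hzb)
    refine ⟨z.arg, ⟨(Complex.neg_pi_lt_arg z).le, Complex.arg_le_pi z⟩, ?_⟩
    have := Complex.norm_mul_exp_arg_mul_I z
    rw [hz1] at this
    simp only [Complex.ofReal_one, one_mul] at this
    show Φ _ = _
    rw [this]

/-- Carathéodory's theorem: `K` is locally connected (at every point) iff every prime end
impression is a single point. -/
theorem stmt6
    (U : Set ℂ∞) (hUopen : IsOpen U) (hUconn : IsConnected U)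
    (hUsc : SimplyConnectedSpace U) (hinfty : ∞ ∈ U)
    (hKconn : IsConnected Uᶜ) (hKnt : Set.Nontrivial Uᶜ)
    (φ : ℂ → ℂ∞) (ψ : ℂ∞ → ℂ)
    (hφcont : ContinuousOn φ (ball (0 : ℂ) 1))
    (hφmaps : MapsTo φ (ball (0 : ℂ) 1) U)
    (hφhol : HolomorphicIntoSphereOn φ (ball (0 : ℂ) 1))
    (hψcont : ContinuousOn ψ U)
    (hψmaps : MapsTo ψ U (ball (0 : ℂ) 1))
    (hψφ : ∀ z ∈ ball (0 : ℂ) 1, ψ (φ z) = z)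
    (hφψ : ∀ w ∈ U, φ (ψ w) = w) :
    (∀ z ∈ Uᶜ, LocallyConnectedAt Uᶜ z) ↔
      ∀ ζ ∈ sphere (0 : ℂ) 1, ∃ z : ℂ∞, impression φ ζ = {z} := by
  exact ⟨stmt6_mp U hUopen hinfty φ ψ hφcont hφmaps hφhol hψcont hψmaps hψφ hφψ,
    stmt6_mpr U hUopen hinfty φ ψ hφcont hφmaps hψcont hψmaps hψφ hφψ⟩

end
end
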